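/- arXiv:2109.13218 — 4 statements merged into one kernel-verified Lean document; each statement's English description precedes it below -/
import Mathlib

section
/- Let p be an odd prime, d ≥ 1 an integer, and let k, k′ be positive even integers such that (p−1) does not divide k and k ≡ k′ (mod p^{d−1}(p−1)). Then the rational numbers (1−p^{k−1})·(−B_k/k) and (1−p^{k′−1})·(−B_{k′}/k′) are both p-integral (their p-adic valuations are ≥ 0) and are congruent modulo p^d, i.e. the p-adic valuation of their difference is at least d. -/
open Finset Filter Topology

/-- Units modulo `n` are permuted by multiplication by `c`. -/
lemma kummer_perm (p : ℕ) (hp : p.Prime) (c : ℕ) (hc : c.Coprime p) (N : ℕ) (f : ℕ → ℤ) :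
    ∑ a ∈ (range (p ^ (N + 1))).filter (fun a => ¬ p ∣ a), f (c * a % p ^ (N + 1)) =
    ∑ a ∈ (range (p ^ (N + 1))).filter (fun a => ¬ p ∣ a), f a := by
  have hpos : 0 < p ^ (N + 1) := pow_pos hp.pos _
  have hmaps : Set.MapsTo (fun a => c * a % p ^ (N + 1))
      ((range (p ^ (N + 1))).filter (fun a => ¬ p ∣ a) : Finset ℕ)
      ((range (p ^ (N + 1))).filter (fun a => ¬ p ∣ a) : Finset ℕ) := by
    intro a ha
    simp only [coe_filter, mem_range, Set.mem_setOf_eq] at ha ⊢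
    refine ⟨Nat.mod_lt _ hpos, fun h => ?_⟩
    rw [Nat.dvd_mod_iff (dvd_pow_self p (Nat.succ_ne_zero N))] at h
    rcases hp.dvd_mul.mp h with h | h
    · exact (hp.coprime_iff_not_dvd.mp hc.symm) h
    · exact ha.2 h
  have hinj : Set.InjOn (fun a => c * a % p ^ (N + 1))
      ((range (p ^ (N + 1))).filter (fun a => ¬ p ∣ a) : Finset ℕ) := by
    intro a ha b hb hab
    simp only [coe_filter, mem_range, Set.mem_setOf_eq] at ha hb
    have h1 : c * a ≡ c * b [MOD p ^ (N + 1)] := hab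
    have h2 : a ≡ b [MOD p ^ (N + 1)] :=
      Nat.ModEq.cancel_left_of_coprime (Nat.Coprime.pow_left _ hc.symm) h1
    exact Nat.ModEq.eq_of_lt_of_lt h2 ha.1 hb.1
  exact Finset.sum_nbij (fun a => c * a % p ^ (N + 1)) hmaps hinj
    (Finset.surjOn_of_injOn_of_card_le _ hmaps hinj le_rfl) (fun _ _ => rfl)

/-- The basic congruence. -/
lemma kummer_basic (p : ℕ) (hp : p.Prime) (c : ℕ) (hc : c.Coprime p) (N k : ℕ) :
    ((p : ℤ) ^ (N + 1)) ^ 2 ∣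
      ((c : ℤ) ^ k - 1) * (∑ a ∈ (range (p ^ (N + 1))).filter (fun a => ¬ p ∣ a), (a : ℤ) ^ k)
      - k * (p : ℤ) ^ (N + 1) *
        ∑ a ∈ (range (p ^ (N + 1))).filter (fun a => ¬ p ∣ a),
          ((c * a / p ^ (N + 1) : ℕ) : ℤ) * ((c : ℤ) * a) ^ (k - 1) := by
  have h := kummer_perm p hp c hc N (fun a => (a : ℤ) ^ k)
  rw [sub_mul, one_mul]
  nth_rewrite 2 [← h]
  rw [mul_sum, mul_sum, ← sum_sub_distrib, ← sum_sub_distrib]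
  refine dvd_sum fun a _ => ?_
  have h1 : ((c * a % p ^ (N + 1) : ℕ) : ℤ) =
      (c : ℤ) * a + -((p : ℤ) ^ (N + 1) * ((c * a / p ^ (N + 1) : ℕ) : ℤ)) := by
    have := Nat.mod_add_div (c * a) (p ^ (N + 1))
    have h3 : ((c * a % p ^ (N + 1) : ℕ) : ℤ) + (p : ℤ) ^ (N + 1) *
      ((c * a / p ^ (N + 1) : ℕ) : ℤ) = c * a := by exact_mod_cast this
    linarith
  obtain ⟨z, hz⟩ := Polynomial.powAddExpansion ((c : ℤ) * a)
    (-((p : ℤ) ^ (N + 1) * ((c * a / p ^ (N + 1) : ℕ) : ℤ))) k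
  rw [h1, hz]
  generalize ((c * a / p ^ (N + 1) : ℕ) : ℤ) = q
  refine ⟨-(z * q ^ 2), ?_⟩
  rw [← mul_pow]
  ring

lemma kummer_split (p : ℕ) (hp : p.Prime) (N k : ℕ) :
    ∑ a ∈ (range (p ^ (N + 1))).filter (fun a => ¬ p ∣ a), (a : ℤ) ^ k =
    ∑ a ∈ range (p ^ (N + 1)), (a : ℤ) ^ k - p ^ k * ∑ a ∈ range (p ^ N), (a : ℤ) ^ k := by
  rw [← sum_filter_add_sum_filter_not (range (p ^ (N + 1))) (fun a => p ∣ a), mul_sum]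
  have : ∑ a ∈ (range (p ^ (N + 1))).filter (fun a => p ∣ a), (a : ℤ) ^ k =
      ∑ a ∈ range (p ^ N), (p : ℤ) ^ k * (a : ℤ) ^ k := by
    symm
    refine Finset.sum_nbij (fun a => p * a) ?_ ?_ ?_ ?_
    · intro a ha
      simp only [mem_filter, mem_range] at ha ⊢
      refine ⟨?_, dvd_mul_right _ _⟩
      rw [pow_succ']
      exact Nat.mul_lt_mul_of_pos_left ha hp.pos
    · intro a _ b _ hab
      exact Nat.eq_of_mul_eq_mul_left hp.pos hab
    · rintro a ha
      simp only [coe_filter, mem_range, Set.mem_setOf_eq] at ha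
      obtain ⟨h1, b, rfl⟩ := ha
      refine ⟨b, ?_, rfl⟩
      simp only [coe_range, Set.mem_Iio]
      rw [pow_succ'] at h1
      exact Nat.lt_of_mul_lt_mul_left h1
    · intro a _
      push_cast
      rw [mul_pow]
  rw [this]
  ring

lemma kummer_lim (p : ℕ) [hp : Fact p.Prime] (k : ℕ) :
    Tendsto (fun N : ℕ => ((∑ a ∈ range (p ^ N), (a : ℤ) ^ k : ℤ) : ℚ_[p]) / (p : ℚ_[p]) ^ N)
      atTop (𝓝 ((bernoulli k : ℚ) : ℚ_[p])) := by
  have hp0 : (p : ℚ_[p]) ≠ 0 := by exact_mod_cast hp.out.ne_zero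
  have hk0 : ((k : ℚ_[p]) + 1) ≠ 0 := by exact_mod_cast k.succ_ne_zero
  have h0 : Tendsto (fun N : ℕ => (p : ℚ_[p]) ^ N) atTop (𝓝 0) :=
    tendsto_pow_atTop_nhds_zero_of_norm_lt_one Padic.norm_p_lt_one
  let F : ℚ_[p] → ℚ_[p] := fun x => ∑ i ∈ range (k + 1),
    ((bernoulli i : ℚ) : ℚ_[p]) * ((k + 1).choose i) * x ^ (k - i) / (k + 1)
  have hF : Continuous F := by
    refine continuous_finset_sum _ fun i _ => ?_
    exact ((continuous_const.mul (continuous_pow _)).div_const _)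
  have hF0 : F 0 = ((bernoulli k : ℚ) : ℚ_[p]) := by
    simp only [F]
    rw [sum_range_succ, sum_eq_zero]
    · simp
      field_simp
    · intro i hi
      have : k - i ≠ 0 := by have := mem_range.mp hi; omega
      simp [this]
  have h1 : Tendsto (fun N : ℕ => F ((p : ℚ_[p]) ^ N)) atTop (𝓝 (F 0)) :=
    (hF.tendsto 0).comp h0
  rw [hF0] at h1
  refine h1.congr fun N => ?_
  have h2 := congrArg (fun q : ℚ => (q : ℚ_[p])) (sum_range_pow (p ^ N) k)
  push_cast at h2 ⊢
  rw [h2, sum_div]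
  refine sum_congr rfl fun i hi => ?_
  have : k + 1 - i = (k - i) + 1 := by have := mem_range.mp hi; omega
  rw [this, pow_succ]
  field_simp

/-- The integer approximating `(c^k-1)(1-p^(k-1)) B_k/k`. -/
def kummerT (p c N k : ℕ) : ℤ :=
  ∑ a ∈ (range (p ^ (N + 1))).filter (fun a => ¬ p ∣ a),
    ((c * a / p ^ (N + 1) : ℕ) : ℤ) * ((c : ℤ) * a) ^ (k - 1)

lemma kummer_T_lim (p : ℕ) [hp : Fact p.Prime] (c : ℕ) (hc : c.Coprime p) (k : ℕ) (hk : 0 < k) :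
    Tendsto (fun N : ℕ => ((kummerT p c N k : ℤ) : ℚ_[p])) atTop
      (𝓝 (-(((c : ℚ_[p]) ^ k - 1) *
        (((1 - (p : ℚ) ^ (k - 1)) * (-bernoulli k / k) : ℚ) : ℚ_[p])))) := by
  have hp0 : (p : ℚ_[p]) ≠ 0 := by exact_mod_cast hp.out.ne_zero
  have hk0 : (k : ℚ_[p]) ≠ 0 := by exact_mod_cast hk.ne'
  let S : ℕ → ℚ_[p] := fun N =>
    ((∑ a ∈ range (p ^ N), (a : ℤ) ^ k : ℤ) : ℚ_[p]) / (p : ℚ_[p]) ^ N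
  have hS := kummer_lim p k
  have hG : Tendsto (fun N : ℕ => ((c : ℚ_[p]) ^ k - 1) / k *
      (S (N + 1) - (p : ℚ_[p]) ^ (k - 1) * S N)) atTop
      (𝓝 (-(((c : ℚ_[p]) ^ k - 1) *
        (((1 - (p : ℚ) ^ (k - 1)) * (-bernoulli k / k) : ℚ) : ℚ_[p])))) := by
    have := (((hS.comp (tendsto_add_atTop_nat 1)).sub
      (hS.const_mul ((p : ℚ_[p]) ^ (k - 1)))).const_mul (((c : ℚ_[p]) ^ k - 1) / k))
    have e : -(((c : ℚ_[p]) ^ k - 1) *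
        (((1 - (p : ℚ) ^ (k - 1)) * (-bernoulli k / k) : ℚ) : ℚ_[p])) =
        ((c : ℚ_[p]) ^ k - 1) / k * (((bernoulli k : ℚ) : ℚ_[p]) -
          (p : ℚ_[p]) ^ (k - 1) * ((bernoulli k : ℚ) : ℚ_[p])) := by
      push_cast
      ring
    rw [e]
    exact this
  have h0 : Tendsto (fun N : ℕ => (p : ℚ_[p]) ^ (N + 1)) atTop (𝓝 0) :=
    (tendsto_pow_atTop_nhds_zero_of_norm_lt_one Padic.norm_p_lt_one).comp
      (tendsto_add_atTop_nat 1)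
  have hD : Tendsto (fun N : ℕ => ((kummerT p c N k : ℤ) : ℚ_[p]) - ((c : ℚ_[p]) ^ k - 1) / k *
      (S (N + 1) - (p : ℚ_[p]) ^ (k - 1) * S N)) atTop (𝓝 0) := by
    have h1 : Tendsto (fun N : ℕ => ‖(p : ℚ_[p]) ^ (N + 1) / k‖) atTop (𝓝 0) := by
      simpa using (h0.div_const (k : ℚ_[p])).norm
    refine squeeze_zero_norm (fun N => ?_) h1
    obtain ⟨z, hz⟩ := kummer_basic p hp.out c hc N k
    change _ - _ * kummerT p c N k = _ at hz
    rw [kummer_split p hp.out] at hz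
    have hz' := congrArg (fun q : ℤ => (q : ℚ_[p])) hz
    have e1 : ((∑ a ∈ range (p ^ (N+1)), (a : ℤ) ^ k : ℤ) : ℚ_[p]) =
        S (N + 1) * (p : ℚ_[p]) ^ (N+1) := by simp only [S]; field_simp
    have e2 : ((∑ a ∈ range (p ^ N), (a : ℤ) ^ k : ℤ) : ℚ_[p]) =
        S N * (p : ℚ_[p]) ^ N := by simp only [S]; field_simp
    simp only [Int.cast_sub, Int.cast_mul, Int.cast_pow, Int.cast_natCast, Int.cast_one,
      e1, e2] at hz'
    have hpk : (p : ℚ_[p]) ^ k = (p : ℚ_[p]) ^ (k - 1) * p := by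
      rw [← pow_succ]; congr 1; omega
    rw [hpk] at hz'
    have key : ((kummerT p c N k : ℤ) : ℚ_[p]) - ((c : ℚ_[p]) ^ k - 1) / k *
      (S (N + 1) - (p : ℚ_[p]) ^ (k - 1) * S N) = -((p : ℚ_[p]) ^ (N + 1) / k * z) := by
      have hpn : (p : ℚ_[p]) ^ (N + 1) ≠ 0 := pow_ne_zero _ hp0
      have e3 : (p : ℚ_[p]) ^ (N + 1) = (p : ℚ_[p]) ^ N * p := pow_succ _ _
      clear_value S
      generalize S (N + 1) = s1 at *
      generalize S N = s2 at *
      have e4 : ((c : ℚ_[p]) ^ k - 1) / k * k = (c : ℚ_[p]) ^ k - 1 := div_mul_cancel₀ _ hk0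
      have e5 : (p : ℚ_[p]) ^ (N + 1) / k * k = (p : ℚ_[p]) ^ (N + 1) := div_mul_cancel₀ _ hk0
      generalize ((c : ℚ_[p]) ^ k - 1) / k = u at *
      generalize (p : ℚ_[p]) ^ (N + 1) / k = v at *
      rw [← e4] at hz'
      apply mul_left_cancel₀ (mul_ne_zero hk0 hpn)
      rw [e3] at hz' e5 ⊢
      linear_combination -hz' + (p : ℚ_[p]) ^ N * p * z * e5
    rw [key, norm_neg, norm_mul]
    exact mul_le_of_le_one_right (norm_nonneg _) (Padic.norm_int_le_one z)
  have := hD.add hG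
  simpa using this

lemma kummer_pow_modEq (p d k k' x : ℕ) (hp : p.Prime) (hd : 1 ≤ d) (hx : x.Coprime p)
    (h : k ≡ k' [MOD p ^ (d - 1) * (p - 1)]) : (p : ℤ) ^ d ∣ (x : ℤ) ^ k - (x : ℤ) ^ k' := by
  have hx' : x.Coprime (p ^ d) := Nat.Coprime.pow_right _ hx
  have hu := Nat.ModEq.pow_totient hx'
  rw [Nat.totient_prime_pow hp hd] at hu
  have hmain : ∀ a b : ℕ, a ≤ b → a ≡ b [MOD p ^ (d - 1) * (p - 1)] →
      x ^ a ≡ x ^ b [MOD p ^ d] := by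
    intro a b hab hm
    obtain ⟨t, ht⟩ := (Nat.modEq_iff_dvd' hab).mp hm
    have : b = a + p ^ (d - 1) * (p - 1) * t := by omega
    rw [this, pow_add, pow_mul]
    simpa using ((hu.pow t).symm).mul_left (x ^ a)
  have h2 : x ^ k' ≡ x ^ k [MOD p ^ d] := by
    rcases le_total k k' with h1 | h1
    · exact (hmain k k' h1 h).symm
    · exact hmain k' k h1 h.symm
  exact_mod_cast (Nat.modEq_iff_dvd.mp h2)

lemma kummer_T_cong (p d k k' c N : ℕ) (hp : p.Prime) (hd : 1 ≤ d) (hc : c.Coprime p)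
    (hk : 0 < k) (hk' : 0 < k')
    (h : k ≡ k' [MOD p ^ (d - 1) * (p - 1)]) :
    (p : ℤ) ^ d ∣ kummerT p c N k - kummerT p c N k' := by
  unfold kummerT
  rw [← sum_sub_distrib]
  refine dvd_sum fun a ha => ?_
  rw [← mul_sub]
  refine Dvd.dvd.mul_left ?_ _
  have h' : k - 1 ≡ k' - 1 [MOD p ^ (d - 1) * (p - 1)] := by
    apply Nat.ModEq.add_right_cancel' 1
    rwa [Nat.sub_add_cancel hk, Nat.sub_add_cancel hk']
  have hca : (c * a).Coprime p :=
    Nat.Coprime.mul_left hc ((hp.coprime_iff_not_dvd.mpr (mem_filter.mp ha).2).symm)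
  exact_mod_cast kummer_pow_modEq p d (k - 1) (k' - 1) (c * a) hp hd hca h'

lemma kummer_exists_c (p : ℕ) [hp : Fact p.Prime] (k : ℕ) (h : ¬ (p - 1) ∣ k) :
    ∃ c : ℕ, c.Coprime p ∧ ¬ (p : ℤ) ∣ (c : ℤ) ^ k - 1 := by
  obtain ⟨g, hg⟩ := IsCyclic.exists_generator (α := (ZMod p)ˣ)
  refine ⟨(g : ZMod p).val, ZMod.val_coe_unit_coprime g, fun hd => h ?_⟩
  have h1 := (ZMod.intCast_zmod_eq_zero_iff_dvd _ p).mpr hd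
  push_cast at h1
  rw [ZMod.natCast_zmod_val, sub_eq_zero] at h1
  have h2 : g ^ k = 1 := by ext; simpa using h1
  have h3 := orderOf_dvd_of_pow_eq_one h2
  rwa [orderOf_eq_card_of_forall_mem_zpowers hg, Nat.card_eq_fintype_card,
    ZMod.card_units] at h3

lemma kummer_val_of_norm (p : ℕ) [hp : Fact p.Prime] (q : ℚ) (d : ℕ) (hq : q ≠ 0)
    (h : ‖(q : ℚ_[p])‖ ≤ (p : ℝ) ^ (-(d : ℤ))) : (d : ℤ) ≤ padicValRat p q := by
  rw [Padic.eq_padicNorm, padicNorm.eq_zpow_of_nonzero hq] at h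
  push_cast at h
  have h1 : (1 : ℝ) < p := by exact_mod_cast hp.out.one_lt
  have := (zpow_le_zpow_iff_right₀ h1).mp h
  omega

lemma kummer_unit_norm (p : ℕ) [hp : Fact p.Prime] (c k : ℕ) (h : ¬ (p : ℤ) ∣ (c : ℤ) ^ k - 1) :
    ‖(c : ℚ_[p]) ^ k - 1‖ = 1 := by
  have h1 : ‖(((c : ℤ) ^ k - 1 : ℤ) : ℚ_[p])‖ = 1 := by
    refine le_antisymm (Padic.norm_int_le_one _) (not_lt.mp fun hh => h ?_)
    exact Padic.norm_intCast_lt_one_iff.mp hh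
  simpa using h1

lemma kummer_int (p : ℕ) [hp : Fact p.Prime] (c k : ℕ) (hc : c.Coprime p) (hk : 0 < k)
    (h : ¬ (p : ℤ) ∣ (c : ℤ) ^ k - 1) :
    ‖(((1 - (p : ℚ) ^ (k - 1)) * (-bernoulli k / k) : ℚ) : ℚ_[p])‖ ≤ 1 := by
  have h1 := (kummer_T_lim p c hc k hk).norm
  rw [norm_neg, norm_mul, kummer_unit_norm p c k h, one_mul] at h1
  exact le_of_tendsto' h1 fun N => Padic.norm_int_le_one _


/-- **Kummer's congruences** for the special values `ζ(1-k) = -B_k/k` of the Riemann zeta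
function at negative odd integers.  For an odd prime `p`, `d ≥ 1`, and positive even
integers `k, k'` with `(p-1) ∤ k` and `k ≡ k' (mod p^(d-1)(p-1))`, both
`(1 - p^(k-1)) ⬝ (-B_k/k)` and `(1 - p^(k'-1)) ⬝ (-B_{k'}/k')` are `p`-integral and they
are congruent modulo `p^d` (congruence modulo `p^d` being expressed by saying that the
difference either vanishes or has `p`-adic valuation at least `d`). -/
theorem kummer_congruence (p : ℕ) (hp : p.Prime) (hp2 : p ≠ 2)
    (d : ℕ) (hd : 1 ≤ d) (k k' : ℕ) (hk : 0 < k) (hk' : 0 < k')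
    (hke : Even k) (hk'e : Even k') (hndvd : ¬ (p - 1) ∣ k)
    (hcong : k ≡ k' [MOD p ^ (d - 1) * (p - 1)]) :
    0 ≤ padicValRat p ((1 - (p : ℚ) ^ (k - 1)) * (-bernoulli k / k)) ∧
    0 ≤ padicValRat p ((1 - (p : ℚ) ^ (k' - 1)) * (-bernoulli k' / k')) ∧
    ((1 - (p : ℚ) ^ (k - 1)) * (-bernoulli k / k)
        - (1 - (p : ℚ) ^ (k' - 1)) * (-bernoulli k' / k') = 0 ∨
      (d : ℤ) ≤ padicValRat p ((1 - (p : ℚ) ^ (k - 1)) * (-bernoulli k / k)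
        - (1 - (p : ℚ) ^ (k' - 1)) * (-bernoulli k' / k'))) := by

  haveI : Fact p.Prime := ⟨hp⟩
  obtain ⟨c, hc, hck⟩ := kummer_exists_c p k hndvd
  have hcc := kummer_pow_modEq p d k k' c hp hd hc hcong
  have hck' : ¬ (p : ℤ) ∣ (c : ℤ) ^ k' - 1 := by
    intro hh
    apply hck
    have h1 : (p : ℤ) ∣ (c : ℤ) ^ k - (c : ℤ) ^ k' :=
      (dvd_pow_self _ (by omega)).trans hcc
    have := dvd_add h1 hh
    simpa using this
  have hi := kummer_int p c k hc hk hck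
  have hi' := kummer_int p c k' hc hk' hck'
  have hl := kummer_T_lim p c hc k hk
  have hl' := kummer_T_lim p c hc k' hk'
  have hval : ∀ q : ℚ, ‖(q : ℚ_[p])‖ ≤ 1 → 0 ≤ padicValRat p q := by
    intro q hq
    by_cases h0 : q = 0
    · simp [h0]
    · simpa using kummer_val_of_norm p q 0 h0 (by simpa using hq)
  refine ⟨hval _ hi, hval _ hi', ?_⟩
  rw [or_iff_not_imp_left]
  intro hne
  refine kummer_val_of_norm p _ d hne ?_
  generalize (1 - (p : ℚ) ^ (k - 1)) * (-bernoulli k / k) = Z at *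
  generalize (1 - (p : ℚ) ^ (k' - 1)) * (-bernoulli k' / k') = Z' at *
  have hu := kummer_unit_norm p c k hck
  have hsub := (hl.sub hl').norm
  have hb : ‖-(((c : ℚ_[p]) ^ k - 1) * (Z : ℚ_[p])) - -(((c : ℚ_[p]) ^ k' - 1) * (Z' : ℚ_[p]))‖
      ≤ (p : ℝ) ^ (-(d : ℤ)) := by
    refine le_of_tendsto' hsub fun N => ?_
    rw [← Int.cast_sub, Padic.norm_int_le_pow_iff_dvd]
    exact_mod_cast kummer_T_cong p d k k' c N hp hd hc hk hk' hcong
  have hcn : ‖(((c : ℤ) ^ k - (c : ℤ) ^ k' : ℤ) : ℚ_[p])‖ ≤ (p : ℝ) ^ (-(d : ℤ)) := by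
    rw [Padic.norm_int_le_pow_iff_dvd]
    exact_mod_cast hcc
  have e : ((c : ℚ_[p]) ^ k - 1) * ((Z - Z' : ℚ) : ℚ_[p]) =
      -(-(((c : ℚ_[p]) ^ k - 1) * (Z : ℚ_[p])) - -(((c : ℚ_[p]) ^ k' - 1) * (Z' : ℚ_[p])))
      + -((((c : ℤ) ^ k - (c : ℤ) ^ k' : ℤ) : ℚ_[p]) * (Z' : ℚ_[p])) := by
    push_cast
    ring
  have e2 : ‖((Z - Z' : ℚ) : ℚ_[p])‖ = ‖((c : ℚ_[p]) ^ k - 1) * ((Z - Z' : ℚ) : ℚ_[p])‖ := by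
    rw [norm_mul, hu, one_mul]
  rw [e2, e]
  refine (Padic.nonarchimedean _ _).trans (max_le ?_ ?_)
  · rwa [norm_neg]
  · rw [norm_neg, norm_mul]
    exact (mul_le_of_le_one_right (norm_nonneg _) hi').trans hcn
end

section
/- Let K be a number field with ring of integers 𝒪, and let α₃, α₄ ∈ K be not both zero; set 𝔟 = α₃𝒪 + α₄𝒪, a nonzero fractional ideal of K. Then there exist α₁, α₂ ∈ K such that α₁α₄ − α₂α₃ = 1 and α₁𝒪 + α₂𝒪 = 𝔟⁻¹. (Equivalently: every cusp (−α₄ : α₃) ∈ ℙ¹(K) can be moved to ∞ by a determinant-one matrix A = (α₁ α₂; α₃ α₄) whose top row generates the inverse of the fractional ideal generated by its bottom row.) -/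
open NumberField
open scoped nonZeroDivisors

/-- **Every cusp can be moved to `∞` by a determinant-one matrix adapted to its ideal.**
Let `K` be a number field with ring of integers `𝒪` and let `α₃, α₄ ∈ K` be not both
zero, generating the nonzero fractional ideal `𝔟 = α₃𝒪 + α₄𝒪`.  Then there are
`α₁, α₂ ∈ K` with `α₁α₄ - α₂α₃ = 1` and `α₁𝒪 + α₂𝒪 = 𝔟⁻¹`. -/
theorem exists_top_row_generating_inverse_ideal (K : Type*) [Field K] [NumberField K]
    (α₃ α₄ : K) (h : (α₃, α₄) ≠ (0, 0)) :
    ∃ α₁ α₂ : K, α₁ * α₄ - α₂ * α₃ = 1 ∧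
      FractionalIdeal.spanSingleton (𝓞 K)⁰ α₁ + FractionalIdeal.spanSingleton (𝓞 K)⁰ α₂
        = (FractionalIdeal.spanSingleton (𝓞 K)⁰ α₃
            + FractionalIdeal.spanSingleton (𝓞 K)⁰ α₄)⁻¹ := by
  classical
  set B := FractionalIdeal.spanSingleton (𝓞 K)⁰ α₃
            + FractionalIdeal.spanSingleton (𝓞 K)⁰ α₄ with hB
  have h3 : α₃ ∈ B := by
    rw [hB, FractionalIdeal.mem_add]
    exact ⟨α₃, FractionalIdeal.mem_spanSingleton_self _ _, 0, FractionalIdeal.zero_mem _, by simp⟩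
  have h4 : α₄ ∈ B := by
    rw [hB, FractionalIdeal.mem_add]
    exact ⟨0, FractionalIdeal.zero_mem _, α₄, FractionalIdeal.mem_spanSingleton_self _ _, by simp⟩
  have hB0 : B ≠ 0 := by
    intro h0
    rw [h0, FractionalIdeal.mem_zero_iff] at h3 h4
    exact h (by rw [h3, h4])
  have hBB : B * B⁻¹ = 1 := mul_inv_cancel₀ hB0
  have h1 : (1 : K) ∈ B * B⁻¹ := by
    rw [hBB]
    exact FractionalIdeal.one_mem_one _
  rw [hB, add_mul, ← hB, FractionalIdeal.mem_add] at h1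
  obtain ⟨x, hx, y, hy, hxy⟩ := h1
  obtain ⟨u, hu, rfl⟩ := FractionalIdeal.mem_singleton_mul.1 hx
  obtain ⟨v, hv, rfl⟩ := FractionalIdeal.mem_singleton_mul.1 hy
  have hu' : -u ∈ B⁻¹ := (B⁻¹ : FractionalIdeal (𝓞 K)⁰ K).coeToSubmodule.neg_mem hu
  have hdet : v * α₄ - -u * α₃ = 1 := by linear_combination hxy
  refine ⟨v, -u, hdet, ?_⟩
  set I := FractionalIdeal.spanSingleton (𝓞 K)⁰ v
            + FractionalIdeal.spanSingleton (𝓞 K)⁰ (-u) with hI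
  have hvI : v ∈ I := by
    rw [hI, FractionalIdeal.mem_add]
    exact ⟨v, FractionalIdeal.mem_spanSingleton_self _ _, 0, FractionalIdeal.zero_mem _, by simp⟩
  have huI : -u ∈ I := by
    rw [hI, FractionalIdeal.mem_add]
    exact ⟨0, FractionalIdeal.zero_mem _, -u, FractionalIdeal.mem_spanSingleton_self _ _, by simp⟩
  have hle : I ≤ B⁻¹ := by
    rw [hI, ← FractionalIdeal.sup_eq_add]
    exact sup_le (FractionalIdeal.spanSingleton_le_iff_mem.2 hv)
      (FractionalIdeal.spanSingleton_le_iff_mem.2 hu')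
  have hone : 1 ≤ I * B := by
    rw [FractionalIdeal.one_le, ← hdet]
    exact (I * B).coeToSubmodule.sub_mem (FractionalIdeal.mul_mem_mul hvI h4)
      (FractionalIdeal.mul_mem_mul huI h3)
  refine le_antisymm hle ?_
  calc B⁻¹ = 1 * B⁻¹ := (one_mul _).symm
    _ ≤ I * B * B⁻¹ := by gcongr
    _ = I := by rw [mul_assoc, hBB, mul_one]
end

section
/- Let 𝔫 be a nonzero integral ideal and 𝔞 a nonzero fractional ideal of K, let a₁, a₂ ∈ 𝔞, let k ≥ 3 be an integer and z ∈ ℍ^r. Then the family of complex numbers [(c,d)] ↦ N(𝔞)^k/(cz+d)^k, indexed by the 𝔫⁺-equivalence classes of pairs (c,d) ∈ 𝔞 × 𝔞 with (c,d) ≠ (0,0), c − a₁ ∈ 𝔫𝔞 and d − a₂ ∈ 𝔫𝔞, is absolutely summable: the sum of the absolute values |N(𝔞)^k/(cz+d)^k| over these equivalence classes is finite. -/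
open NumberField
open scoped nonZeroDivisors

variable (K : Type*) [Field K] [NumberField K]

/-- Two pairs `(c,d), (c',d') ∈ K × K` are `𝔫⁺`-equivalent if there is a totally positive
unit `ε ∈ 𝒪ˣ` with `ε ≡ 1 mod 𝔫` such that `c = εc'` and `d = εd'`. -/
def NPlusEquiv (𝔫 : Ideal (𝓞 K)) (v w : K × K) : Prop :=
  ∃ ε : (𝓞 K)ˣ, (∀ σ : K →+* ℝ, 0 < σ (algebraMap (𝓞 K) K ε)) ∧ ((ε : 𝓞 K) - 1) ∈ 𝔫 ∧
    v.1 = algebraMap (𝓞 K) K ε * w.1 ∧ v.2 = algebraMap (𝓞 K) K ε * w.2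

/-- `S` is a set of representatives for the `𝔫⁺`-equivalence classes of pairs
satisfying the predicate `P`. -/
def IsNPlusRepSet (𝔫 : Ideal (𝓞 K)) (P : K × K → Prop) (S : Set (K × K)) : Prop :=
  (∀ v ∈ S, P v) ∧ ∀ v, P v → ∃! w, w ∈ S ∧ NPlusEquiv K 𝔫 v w

/-- The Eisenstein summand `N(𝔞)^k / (cz+d)^k`, where
`(cz+d)^k = ∏_σ (σ(c) z_σ + σ(d))^k` over the real embeddings `σ` of `K`. -/
noncomputable def eisTerm (𝔞 : FractionalIdeal (𝓞 K)⁰ K) (k : ℕ) (z : (K →+* ℝ) → ℂ)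
    (v : K × K) : ℂ :=
  (FractionalIdeal.absNorm 𝔞 : ℂ) ^ k /
    ∏ σ : K →+* ℝ, ((σ v.1 : ℂ) * z σ + (σ v.2 : ℂ)) ^ k


open NumberField.InfinitePlace in
lemma real_places (htr : Fintype.card (K →+* ℝ) = Module.finrank ℚ K) :
    IsTotallyReal K ∧ ∃ e : (K →+* ℝ) ≃ InfinitePlace K, ∀ σ x, e σ x = |σ x| := by
  have hinj : Function.Injective (fun σ : K →+* ℝ => Complex.ofRealHom.comp σ) := by
    intro σ τ h
    ext x
    have := RingHom.congr_fun h x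
    simpa using this
  have hbij := (Fintype.bijective_iff_injective_and_card _).2
    ⟨hinj, htr.trans (Embeddings.card K ℂ).symm⟩
  have hreal : ∀ σ : K →+* ℝ, ComplexEmbedding.IsReal (Complex.ofRealHom.comp σ) := by
    intro σ
    rw [ComplexEmbedding.isReal_iff]
    ext x
    simp
  constructor
  · constructor
    intro w
    obtain ⟨φ, rfl⟩ : ∃ φ, InfinitePlace.mk φ = w := ⟨w.embedding, mk_embedding w⟩
    obtain ⟨σ, rfl⟩ := hbij.2 φ
    exact isReal_mk_iff.2 (hreal σ)
  · refine ⟨Equiv.ofBijective (fun σ => InfinitePlace.mk (Complex.ofRealHom.comp σ)) ⟨?_, ?_⟩, ?_⟩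
    · intro σ τ h
      rcases mk_eq_iff.1 h with h | h
      · exact hinj h
      · rw [ComplexEmbedding.isReal_iff.1 (hreal σ)] at h
        exact hinj h
    · intro w
      obtain ⟨σ, hσ⟩ := hbij.2 w.embedding
      exact ⟨σ, (congrArg InfinitePlace.mk hσ).trans (mk_embedding w)⟩
    · intro σ x
      have h : InfinitePlace.mk (Complex.ofRealHom.comp σ) x = ‖(Complex.ofRealHom.comp σ) x‖ :=
        InfinitePlace.apply _ x
      refine h.trans ?_
      simp

open NumberField.InfinitePlace NumberField.Units NumberField.Units.dirichletUnitTheorem in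
lemma units_cobounded [IsTotallyReal K] :
    ∃ B : ℝ, ∀ x : InfinitePlace K → ℝ, ∑ w, x w = 0 →
      ∃ u : (𝓞 K)ˣ, ∀ w : InfinitePlace K, |x w - Real.log (w (u : K))| ≤ B := by
  classical
  let b := (Module.Free.chooseBasis ℤ (unitLattice K)).ofZLatticeBasis ℝ (unitLattice K)
  have hb : Submodule.span ℤ (Set.range b) = unitLattice K :=
    Module.Basis.ofZLatticeBasis_span ℝ (unitLattice K) _
  set C : ℝ := ∑ i, ‖b i‖ with hC
  have hC0 : 0 ≤ C := by positivity
  refine ⟨C * (Fintype.card (InfinitePlace K) + 1), fun x hx => ?_⟩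
  let y : logSpace K := fun w => x w.1
  have hmem : (ZSpan.floor b y : logSpace K) ∈ unitLattice K :=
    hb.le (ZSpan.floor b y).2
  obtain ⟨u, -, hu⟩ := hmem
  refine ⟨Additive.toMul u, ?_⟩
  set v : (𝓞 K)ˣ := Additive.toMul u
  have hle : ‖y - logEmbedding K (Additive.ofMul v)‖ ≤ C := by
    have := ZSpan.norm_fract_le b y
    rw [ZSpan.fract_apply, ← hu] at this
    exact this
  have h1 : ∀ w : {w : InfinitePlace K // w ≠ w₀}, |x w.1 - Real.log (w.1 (v : K))| ≤ C := by
    intro w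
    have := (norm_le_pi_norm _ w).trans hle
    simpa [logEmbedding_component, IsTotallyReal.mult_eq, y] using this
  have h2 := sum_logEmbedding_component v
  simp only [logEmbedding_component, IsTotallyReal.mult_eq, Nat.cast_one, one_mul] at h2
  have h3 : x w₀ + ∑ w : {w : InfinitePlace K // w ≠ w₀}, x w.1 = 0 := by
    rw [← hx, Fintype.sum_eq_add_sum_subtype_ne _ w₀]
  intro w
  by_cases hw : w = w₀
  · subst hw
    have : x w₀ - Real.log (w₀ (v : K)) =
        - ∑ w : {w : InfinitePlace K // w ≠ w₀}, (x w.1 - Real.log (w.1 (v : K))) := by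
      rw [Finset.sum_sub_distrib, h2]; linarith
    rw [this, abs_neg]
    refine (Finset.abs_sum_le_sum_abs _ _).trans ?_
    refine (Finset.sum_le_sum fun i _ => h1 i).trans ?_
    rw [Finset.sum_const, nsmul_eq_mul, mul_comm]
    have : ((Finset.univ : Finset {w : InfinitePlace K // w ≠ w₀}).card : ℝ)
        ≤ Fintype.card (InfinitePlace K) := by
      exact_mod_cast Fintype.card_subtype_le _
    nlinarith
  · refine (h1 ⟨w, hw⟩).trans ?_
    nlinarith [(Nat.cast_nonneg (Fintype.card (InfinitePlace K)) : (0:ℝ) ≤ _)]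

lemma exists_unit_exponent (𝔫 : Ideal (𝓞 K)) (h𝔫 : 𝔫 ≠ ⊥) :
    ∃ m : ℕ, 0 < m ∧ ∀ u : (𝓞 K)ˣ,
      (∀ σ : K →+* ℝ, 0 < σ (algebraMap (𝓞 K) K (u ^ m : (𝓞 K)ˣ))) ∧
        (((u ^ m : (𝓞 K)ˣ) : 𝓞 K) - 1) ∈ 𝔫 := by
  have : Finite (𝓞 K ⧸ 𝔫) := Ideal.finiteQuotientOfFreeOfNeBot 𝔫 h𝔫
  refine ⟨2 * Nat.card (𝓞 K ⧸ 𝔫)ˣ, by have := Nat.card_pos (α := (𝓞 K ⧸ 𝔫)ˣ); omega, fun u => ⟨?_, ?_⟩⟩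
  · intro σ
    have h0 : σ (algebraMap (𝓞 K) K u) ≠ 0 := by
      simp
    rw [pow_mul', Units.val_pow_eq_pow_val, Units.val_pow_eq_pow_val, map_pow, map_pow, map_pow, map_pow]
    exact (even_two.pow_pos (pow_ne_zero _ h0))
  · rw [← Ideal.Quotient.eq, map_one]
    have h := pow_card_eq_one' (x := Units.map (Ideal.Quotient.mk 𝔫).toMonoidHom u)
    have h2 := congrArg Units.val h
    rw [Units.val_pow_eq_pow_val] at h2
    rw [pow_mul', Units.val_pow_eq_pow_val, Units.val_pow_eq_pow_val, map_pow, map_pow]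
    have h3 : (Ideal.Quotient.mk 𝔫) (u : 𝓞 K) ^ Nat.card (𝓞 K ⧸ 𝔫)ˣ = 1 := h2
    rw [h3, one_pow]

lemma exists_balanced [IsTotallyReal K] (m : ℕ) (hm : 0 < m) :
    ∃ D : ℝ, 0 < D ∧ ∀ v : K × K, v ≠ 0 → ∃ u : (𝓞 K)ˣ, ∀ w : InfinitePlace K,
      (max (w (algebraMap (𝓞 K) K (u ^ m : (𝓞 K)ˣ) * v.1))
        (w (algebraMap (𝓞 K) K (u ^ m : (𝓞 K)ˣ) * v.2))) ^ Fintype.card (InfinitePlace K)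
        ≤ D * ∏ w : InfinitePlace K, max (w v.1) (w v.2) := by
  obtain ⟨B, hB⟩ := units_cobounded K
  set r := Fintype.card (InfinitePlace K) with hr
  have hr0 : 0 < r := Fintype.card_pos
  have hr0' : (r : ℝ) ≠ 0 := by positivity
  refine ⟨Real.exp (r * (m * B)), Real.exp_pos _, fun v hv => ?_⟩
  let M : InfinitePlace K → ℝ := fun w => max (w v.1) (w v.2)
  have hM : ∀ w, 0 < M w := by
    intro w
    by_cases h1 : v.1 = 0
    · have h2 : v.2 ≠ 0 := fun h2 => hv (Prod.ext h1 h2)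
      exact lt_max_of_lt_right (InfinitePlace.pos_iff.2 h2)
    · exact lt_max_of_lt_left (InfinitePlace.pos_iff.2 h1)
  set P : ℝ := ∏ w, M w with hP
  have hPpos : 0 < P := Finset.prod_pos fun w _ => hM w
  have hlogP : Real.log P = ∑ w, Real.log (M w) :=
    Real.log_prod fun w _ => (hM w).ne'
  have hm0 : (0 : ℝ) < m := by positivity
  obtain ⟨u, hu⟩ := hB (fun w => (Real.log P / r - Real.log (M w)) / m) (by
    rw [← Finset.sum_div, Finset.sum_sub_distrib, ← hlogP, Finset.sum_const, Finset.card_univ,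
      ← hr, nsmul_eq_mul]
    field_simp
    ring)
  refine ⟨u, fun w => ?_⟩
  have hwu : 0 < w (u : K) := InfinitePlace.pos_iff.2 (by simp)
  have h1 : Real.log (w (u : K)) ≤ (Real.log P / r - Real.log (M w)) / m + B := by
    have := (abs_le.1 (hu w)).1
    linarith
  have h2 : m * Real.log (w (u : K)) + Real.log (M w) ≤ Real.log P / r + m * B := by
    have := mul_le_mul_of_nonneg_left h1 hm0.le
    rw [mul_add, mul_div_cancel₀ _ hm0.ne'] at this
    linarith
  have h3 : max (w (algebraMap (𝓞 K) K (u ^ m : (𝓞 K)ˣ) * v.1))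
        (w (algebraMap (𝓞 K) K (u ^ m : (𝓞 K)ˣ) * v.2)) = w (u : K) ^ m * M w := by
    rw [Units.val_pow_eq_pow_val, map_pow, map_mul, map_mul, map_pow,
      ← mul_max_of_nonneg _ _ (by positivity)]
  rw [h3]
  rw [← Real.log_le_log_iff (pow_pos (mul_pos (pow_pos hwu _) (hM w)) _)
    (mul_pos (Real.exp_pos _) hPpos), Real.log_pow, Real.log_mul (pow_pos hwu _).ne' (hM w).ne',
    Real.log_pow, Real.log_mul (Real.exp_pos _).ne' hPpos.ne', Real.log_exp]
  have h4 := mul_le_mul_of_nonneg_left h2 (Nat.cast_nonneg r : (0 : ℝ) ≤ r)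
  rw [mul_add, mul_add (r : ℝ) (Real.log P / r), mul_div_cancel₀ _ hr0'] at h4
  linarith

lemma summable_comp_inj {Y X : Type*} (N : Y → ℝ)
    (hs : Summable N) (g : X → Y) (hg : Function.Injective g) :
    Summable (fun x => N (g x)) := hs.comp_injective hg

lemma summable_comp_mem {E X : Type*} [NormedAddCommGroup E] (L : Submodule ℤ E) (N : E → ℝ)
    (hs : Summable fun z : L ↦ N z) (g : X → E) (hg : Function.Injective g)
    (hL : ∀ x, g x ∈ L) : Summable (fun x => N (g x)) :=
  summable_comp_inj (fun z : L ↦ N z) hs (fun x => (⟨g x, hL x⟩ : L))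
    (fun _ _ h => hg (Subtype.mk.inj h))

lemma summable_of_mem_lattice {E X : Type*} [NormedAddCommGroup E] [NormedSpace ℝ E]
    [FiniteDimensional ℝ E] (L : Submodule ℤ E) [DiscreteTopology L] (n : ℕ)
    (hn : Module.finrank ℤ L < n) (g : X → E) (hg : Function.Injective g) (hL : ∀ x, g x ∈ L) :
    Summable (fun x => ‖g x‖⁻¹ ^ n) := by
  have hs := ZLattice.summable_norm_pow_inv L n hn
  exact summable_comp_mem L (fun z ↦ ‖z‖⁻¹ ^ n) hs g hg hL

lemma mem_span_prod {E ι : Type*} [AddCommGroup E] [Module ℝ E]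
    (b : Module.Basis ι ℝ E) (x : E × E) (h1 : x.1 ∈ Submodule.span ℤ (Set.range b))
    (h2 : x.2 ∈ Submodule.span ℤ (Set.range b)) :
    x ∈ Submodule.span ℤ (Set.range (b.prod b)) := by
  have h : x ∈ (Submodule.span ℤ (Set.range b)).prod (Submodule.span ℤ (Set.range b)) := ⟨h1, h2⟩
  rw [← LinearMap.span_inl_union_inr] at h
  refine Submodule.span_mono ?_ h
  rintro _ (⟨_, ⟨i, rfl⟩, rfl⟩ | ⟨_, ⟨i, rfl⟩, rfl⟩)
  · exact ⟨Sum.inl i, by ext <;> simp⟩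
  · exact ⟨Sum.inr i, by ext <;> simp⟩

lemma summable_prod_lattice {E ι X : Type*} [NormedAddCommGroup E] [NormedSpace ℝ E]
    [FiniteDimensional ℝ E] [Finite ι] (b : Module.Basis ι ℝ E) (n : ℕ)
    (hn : 2 * Module.finrank ℝ E < n) (g : X → E × E) (hg : Function.Injective g)
    (h1 : ∀ x, (g x).1 ∈ Submodule.span ℤ (Set.range b))
    (h2 : ∀ x, (g x).2 ∈ Submodule.span ℤ (Set.range b)) :
    Summable (fun x => ‖g x‖⁻¹ ^ n) := by
  refine summable_of_mem_lattice (Submodule.span ℤ (Set.range (b.prod b))) n ?_ g hg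
    (fun x => mem_span_prod b _ (h1 x) (h2 x))
  rw [ZLattice.rank ℝ, Module.finrank_prod]
  omega

open scoped Classical in
lemma summable_lattice (𝔞 : FractionalIdeal (𝓞 K)⁰ K) (h𝔞 : 𝔞 ≠ 0) (n : ℕ)
    (hn : 2 * Module.finrank ℚ K < n) :
    Summable (fun v : {v : K × K // v.1 ∈ 𝔞 ∧ v.2 ∈ 𝔞} =>
      ‖(mixedEmbedding K v.1.1, mixedEmbedding K v.1.2)‖⁻¹ ^ n) := by
  have hmem : ∀ x ∈ 𝔞, mixedEmbedding K x ∈ Submodule.span ℤ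
      (Set.range (mixedEmbedding.fractionalIdealLatticeBasis K (Units.mk0 𝔞 h𝔞))) := by
    intro x hx
    rw [mixedEmbedding.mem_span_fractionalIdealLatticeBasis]
    exact ⟨x, hx, rfl⟩
  refine summable_prod_lattice (mixedEmbedding.fractionalIdealLatticeBasis K (Units.mk0 𝔞 h𝔞)) n
    (by rwa [mixedEmbedding.finrank]) (fun v : {v : K × K // v.1 ∈ 𝔞 ∧ v.2 ∈ 𝔞} =>
      (mixedEmbedding K v.1.1, mixedEmbedding K v.1.2)) ?_
    (fun v => hmem _ v.2.1) (fun v => hmem _ v.2.2)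
  intro v w h
  have h2 := Prod.ext_iff.1 h
  exact Subtype.ext (Prod.ext (mixedEmbedding_injective K h2.1) (mixedEmbedding_injective K h2.2))

lemma max_le_norm (z : ℂ) (hz : 0 < z.im) :
    ∃ A : ℝ, 0 < A ∧ ∀ x y : ℝ, max |x| |y| ≤ A * ‖(x : ℂ) * z + y‖ := by
  refine ⟨1 + (1 + ‖z‖) / z.im, by positivity, fun x y => ?_⟩
  set N := ‖(x : ℂ) * z + y‖
  have hN : 0 ≤ N := norm_nonneg _
  have h1 : |x| ≤ N / z.im := by
    rw [le_div_iff₀ hz, ← abs_of_pos hz, ← abs_mul]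
    have := Complex.abs_im_le_norm ((x : ℂ) * z + y)
    simpa [abs_of_pos hz] using this
  have h2 : |y| ≤ N + |x| * ‖z‖ := by
    have h : (y : ℂ) = ((x : ℂ) * z + y) - (x : ℂ) * z := by ring
    calc |y| = ‖(y : ℂ)‖ := by simp
      _ ≤ N + ‖(x : ℂ) * z‖ := by
        conv_lhs => rw [h]
        exact norm_sub_le _ _
      _ = _ := by simp
  have h3 : |x| * ‖z‖ ≤ N / z.im * ‖z‖ := by gcongr
  have h4 : 0 ≤ N / z.im * ‖z‖ := by positivity
  have h5 : 0 ≤ N / z.im := by positivity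
  have h6 : (1 + (1 + ‖z‖) / z.im) * N = N + N / z.im + N / z.im * ‖z‖ := by ring
  rw [h6]
  exact max_le (by linarith) (by linarith)

open scoped Classical in
lemma norm_mixed_pair_le (v : K × K) (n : ℕ) (T : ℝ)
    (h : ∀ w : InfinitePlace K, (max (w v.1) (w v.2)) ^ n ≤ T) :
    ‖(mixedEmbedding K v.1, mixedEmbedding K v.2)‖ ^ n ≤ T := by
  have key : ∀ x : K, ∃ w : InfinitePlace K, ‖mixedEmbedding K x‖ = w x := by
    intro x
    rw [mixedEmbedding.norm_eq_sup'_normAtPlace]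
    obtain ⟨w, -, hw⟩ := Finset.exists_mem_eq_sup' Finset.univ_nonempty
      (fun w => mixedEmbedding.normAtPlace w (mixedEmbedding K x))
    exact ⟨w, by rw [hw, mixedEmbedding.normAtPlace_apply]⟩
  rw [Prod.norm_def]
  rcases max_choice ‖mixedEmbedding K v.1‖ ‖mixedEmbedding K v.2‖ with h1 | h1
  · simp only [h1]
    obtain ⟨w, hw⟩ := key v.1
    rw [hw]
    refine le_trans (pow_le_pow_left₀ (apply_nonneg _ _) (le_max_left _ _) _) (h w)
  · simp only [h1]
    obtain ⟨w, hw⟩ := key v.2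
    rw [hw]
    refine le_trans (pow_le_pow_left₀ (apply_nonneg _ _) (le_max_right _ _) _) (h w)

/-- **Absolute convergence of the partial Eisenstein series.**  Let `K` be a totally real
number field, `𝔫` a nonzero integral ideal, `𝔞` a nonzero fractional ideal, `a₁, a₂ ∈ 𝔞`,
`k ≥ 3`, and `z ∈ ℍ^r`.  The family `[(c,d)] ↦ N(𝔞)^k/(cz+d)^k`, indexed by the
`𝔫⁺`-equivalence classes of pairs `(c,d) ∈ 𝔞 × 𝔞` with `(c,d) ≠ (0,0)`, `c ≡ a₁` and
`d ≡ a₂ mod 𝔫𝔞`, is absolutely summable. -/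
theorem eisenstein_summable
    (htotallyreal : Fintype.card (K →+* ℝ) = Module.finrank ℚ K)
    (𝔫 : Ideal (𝓞 K)) (h𝔫 : 𝔫 ≠ ⊥)
    (𝔞 : FractionalIdeal (𝓞 K)⁰ K) (h𝔞 : 𝔞 ≠ 0)
    (a₁ a₂ : K) (ha₁ : a₁ ∈ 𝔞) (ha₂ : a₂ ∈ 𝔞)
    (k : ℕ) (hk : 3 ≤ k)
    (z : (K →+* ℝ) → ℂ) (hz : ∀ σ, 0 < (z σ).im)
    (S : Set (K × K))
    (hS : IsNPlusRepSet K 𝔫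
      (fun v => v.1 ∈ 𝔞 ∧ v.2 ∈ 𝔞 ∧ v ≠ (0, 0) ∧
        v.1 - a₁ ∈ (𝔫 : FractionalIdeal (𝓞 K)⁰ K) * 𝔞 ∧
        v.2 - a₂ ∈ (𝔫 : FractionalIdeal (𝓞 K)⁰ K) * 𝔞) S) :
    Summable (fun v : S => ‖eisTerm K 𝔞 k z v‖) := by
  classical
  obtain ⟨htr, e, he⟩ := real_places K htotallyreal
  obtain ⟨m, hm, hU⟩ := exists_unit_exponent K 𝔫 h𝔫
  obtain ⟨D, hD, hbal⟩ := exists_balanced K m hm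
  choose A hA hAle using fun σ => max_le_norm (z σ) (hz σ)
  obtain ⟨hS1, hS2⟩ := hS
  have hne : ∀ v : S, (v : K × K) ≠ 0 := fun v => (hS1 v v.2).2.2.1
  choose u hu using fun v : S => hbal v (hne v)
  set r := Fintype.card (InfinitePlace K) with hr
  have hrank : r = Module.finrank ℚ K := by
    rw [← htotallyreal, hr]; exact (Fintype.card_congr e).symm
  have hrpos : 0 < r := Fintype.card_pos
  -- the balanced representative of each class
  let f : S → {v : K × K // v.1 ∈ 𝔞 ∧ v.2 ∈ 𝔞} := fun v =>
    ⟨(algebraMap (𝓞 K) K (u v ^ m : (𝓞 K)ˣ) * v.1.1,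
      algebraMap (𝓞 K) K (u v ^ m : (𝓞 K)ˣ) * v.1.2), by
      have h := hS1 v v.2
      constructor
      · have := Submodule.smul_mem (𝔞 : Submodule (𝓞 K) K) ((u v ^ m : (𝓞 K)ˣ) : 𝓞 K) h.1
        rwa [Algebra.smul_def] at this
      · have := Submodule.smul_mem (𝔞 : Submodule (𝓞 K) K) ((u v ^ m : (𝓞 K)ˣ) : 𝓞 K) h.2.1
        rwa [Algebra.smul_def] at this⟩
  have hequiv : ∀ (x : (𝓞 K)ˣ) (v w : K × K),
      v.1 = algebraMap (𝓞 K) K (x ^ m : (𝓞 K)ˣ) * w.1 →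
      v.2 = algebraMap (𝓞 K) K (x ^ m : (𝓞 K)ˣ) * w.2 → NPlusEquiv K 𝔫 v w :=
    fun x v w h1 h2 => ⟨x ^ m, (hU x).1, (hU x).2, h1, h2⟩
  have hcancel : ∀ (x y : (𝓞 K)ˣ) (a b : K),
      algebraMap (𝓞 K) K (x ^ m : (𝓞 K)ˣ) * a = algebraMap (𝓞 K) K (y ^ m : (𝓞 K)ˣ) * b →
      a = algebraMap (𝓞 K) K ((x⁻¹ * y) ^ m : (𝓞 K)ˣ) * b := by
    intro x y a b h
    have h1 : algebraMap (𝓞 K) K (x ^ m : (𝓞 K)ˣ) ≠ 0 := by simp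
    apply mul_left_cancel₀ h1
    rw [h, ← mul_assoc, ← map_mul, ← Units.val_mul, mul_pow, inv_pow, mul_inv_cancel_left]
  have hf : Function.Injective f := by
    intro v w h
    have h2 := Prod.ext_iff.1 (congrArg Subtype.val h)
    have hvw : NPlusEquiv K 𝔫 v w :=
      hequiv ((u v)⁻¹ * u w) v w (hcancel _ _ _ _ h2.1) (hcancel _ _ _ _ h2.2)
    have hvv : NPlusEquiv K 𝔫 v v := hequiv 1 v v (by simp) (by simp)
    exact Subtype.ext ((hS2 v (hS1 v v.2)).unique ⟨v.2, hvv⟩ ⟨w.2, hvw⟩)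
  have hsum := (summable_lattice K 𝔞 h𝔞 (r * k) (by rw [← hrank]; nlinarith)).comp_injective hf
  refine Summable.of_nonneg_of_le (fun _ => norm_nonneg _) (fun v => ?_)
    (hsum.mul_left ((‖(FractionalIdeal.absNorm 𝔞 : ℂ)‖ * ((∏ σ, A σ) * D)) ^ k))
  set X : ℝ := ‖(mixedEmbedding K (f v).1.1, mixedEmbedding K (f v).1.2)‖ with hX
  set P : ℝ := ∏ w : InfinitePlace K, max (w v.1.1) (w v.1.2) with hP
  set Q : ℝ := ∏ σ : K →+* ℝ, ‖((σ v.1.1 : ℂ) * z σ + (σ v.1.2 : ℂ))‖ with hQ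
  have hXP : X ^ r ≤ D * P := norm_mixed_pair_le K (f v).1 r _ (hu v)
  have hPQ : P ≤ (∏ σ, A σ) * Q := by
    rw [hP, ← Equiv.prod_comp e, hQ, ← Finset.prod_mul_distrib]
    refine Finset.prod_le_prod (fun σ _ => le_max_of_le_left (apply_nonneg _ _)) fun σ _ => ?_
    rw [he, he]
    exact hAle σ _ _
  have hXpos : 0 < X := by
    rw [hX, norm_pos_iff]
    intro h0
    have h1 := Prod.ext_iff.1 h0
    have h2 : (f v).1.1 = 0 := (map_eq_zero (mixedEmbedding K)).1 h1.1
    have h3 : (f v).1.2 = 0 := (map_eq_zero (mixedEmbedding K)).1 h1.2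
    have h4 : algebraMap (𝓞 K) K (u v ^ m : (𝓞 K)ˣ) ≠ 0 := by simp
    exact hne v (Prod.ext ((mul_eq_zero.1 h2).resolve_left h4)
      ((mul_eq_zero.1 h3).resolve_left h4))
  have hAp : 0 < ∏ σ, A σ := Finset.prod_pos fun σ _ => hA σ
  have hXQ : X ^ r ≤ (∏ σ, A σ) * D * Q := by nlinarith
  have hXr : 0 < X ^ r := by positivity
  have hQpos : 0 < Q := by
    by_contra hcon
    have : (∏ σ, A σ) * D * Q ≤ 0 := mul_nonpos_of_nonneg_of_nonpos (by positivity) (not_lt.1 hcon)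
    linarith
  have hnorm : ‖eisTerm K 𝔞 k z v‖ = (‖(FractionalIdeal.absNorm 𝔞 : ℂ)‖ * Q⁻¹) ^ k := by
    rw [eisTerm, norm_div, norm_pow, norm_prod, mul_pow, div_eq_mul_inv, inv_pow, hQ,
      ← Finset.prod_pow]
    simp_rw [norm_pow]
  have hfin : Q⁻¹ ≤ (∏ σ, A σ) * D * (X ^ r)⁻¹ := by
    rw [← div_eq_mul_inv, inv_eq_one_div, div_le_div_iff₀ hQpos hXr]
    linarith
  calc ‖eisTerm K 𝔞 k z v‖ = (‖(FractionalIdeal.absNorm 𝔞 : ℂ)‖ * Q⁻¹) ^ k := hnorm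
    _ ≤ (‖(FractionalIdeal.absNorm 𝔞 : ℂ)‖ * ((∏ σ, A σ) * D * (X ^ r)⁻¹)) ^ k := by gcongr
    _ = (‖(FractionalIdeal.absNorm 𝔞 : ℂ)‖ * ((∏ σ, A σ) * D)) ^ k * X⁻¹ ^ (r * k) := by
      rw [← mul_assoc, mul_pow _ ((X ^ r)⁻¹) k, ← inv_pow, ← pow_mul]
end

section
/- Fix α₁, α₂, α₃, α₄ ∈ K with α₁α₄ − α₂α₃ = 1, let 𝔟 = α₃𝒪 + α₄𝒪 (a nonzero fractional ideal) and assume α₁𝒪 + α₂𝒪 = 𝔟⁻¹. Let 𝔫 be a nonzero integral ideal such that no prime ideal dividing 𝔫 occurs (with nonzero exponent) in the factorization of 𝔟, let 𝔞 be a nonzero fractional ideal, let k ≥ 3 be an integer, and let a₂ ∈ 𝔞 be such that the integral ideal a₂𝒪·𝔞⁻¹ is coprime to 𝔫. Let a₂* ∈ 𝔞𝔟⁻¹ be any element with α₃a₂* ∈ 𝔫𝔞 and α₄a₂* − a₂ ∈ 𝔫𝔞 (such an element exists). For z ∈ ℍ^r let A⁻¹z ∈ ℍ^r have components (A⁻¹z)ᵢ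 = (σᵢ(α₄)zᵢ − σᵢ(α₂))/(−σᵢ(α₃)zᵢ + σᵢ(α₁)), and define F(z) = ∏_{i=1}^r (σᵢ(α₃)·(A⁻¹z)ᵢ + σᵢ(α₄))^k times the sum of N(𝔞)^k/(c·(A⁻¹z)+d)^k over the 𝔫⁺-equivalence classes of pairs (c,d) ∈ 𝔞 × 𝔞 with c𝒪 + d𝒪 = 𝔞, c ∈ 𝔫𝔞 and d − a₂ ∈ 𝔫𝔞. Then the limit of F(it, it, …, it) as the real number t → +∞ exists and equals the sum, over the 𝔫⁺-equivalence classes of nonzero l ∈ 𝔞𝔟⁻¹ with l − a₂* ∈ 𝔫𝔞𝔟⁻¹, of (N(𝔞)^k / N(l)^k) · Σ_{𝔱} μ(𝔱), where the inner sum ranges over the integral ideals 𝔱 that divide the integral ideal l𝒪·𝔞⁻¹𝔟 and satisfy 𝔱 + 𝔫 = 𝒪. (This is the constant term of the Fourier expansion at the cusp ∞ of the partial Eisenstein series slashed by A⁻¹.) -/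
open NumberField
open scoped nonZeroDivisors

variable (K : Type*) [Field K] [NumberField K]

/-- Two elements `l, l' ∈ K` are `𝔫⁺`-equivalent if `l = εl'` for a totally positive unit
`ε ∈ 𝒪ˣ` with `ε ≡ 1 mod 𝔫`. -/
def NPlusEquivElem (𝔫 : Ideal (𝓞 K)) (l l' : K) : Prop :=
  ∃ ε : (𝓞 K)ˣ, (∀ σ : K →+* ℝ, 0 < σ (algebraMap (𝓞 K) K ε)) ∧ ((ε : 𝓞 K) - 1) ∈ 𝔫 ∧
    l = algebraMap (𝓞 K) K ε * l'

/-- `L` is a set of representatives for the `𝔫⁺`-equivalence classes of elements of `K`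
satisfying the predicate `P`. -/
def IsNPlusRepSetElem (𝔫 : Ideal (𝓞 K)) (P : K → Prop) (L : Set K) : Prop :=
  (∀ l ∈ L, P l) ∧ ∀ l, P l → ∃! l', l' ∈ L ∧ NPlusEquivElem K 𝔫 l l'

open scoped Classical in
/-- The Möbius function on nonzero integral ideals: `μ(𝒪) = 1`, `μ(𝔱) = (-1)^s` if `𝔱` is
a product of `s` distinct prime ideals, and `μ(𝔱) = 0` if `𝔱` has a repeated prime
factor. -/
noncomputable def idealMoebius (I : Ideal (𝓞 K)) : ℤ :=
  if Squarefree I then (-1) ^ (UniqueFactorizationMonoid.normalizedFactors I).card else 0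

/-- The components of `A⁻¹z` for `A = (α₁ α₂; α₃ α₄)` of determinant one:
`(A⁻¹z)_σ = (σ(α₄) z_σ - σ(α₂)) / (-σ(α₃) z_σ + σ(α₁))`. -/
noncomputable def matInvSMul (α₁ α₂ α₃ α₄ : K) (z : (K →+* ℝ) → ℂ) : (K →+* ℝ) → ℂ :=
  fun σ => ((σ α₄ : ℂ) * z σ - (σ α₂ : ℂ)) / (-(σ α₃ : ℂ) * z σ + (σ α₁ : ℂ))


set_option linter.unusedSectionVars false
namespace EisCT

lemma exists_places_equiv (htot : Fintype.card (K →+* ℝ) = Module.finrank ℚ K) :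
    ∃ e : (K →+* ℝ) ≃ InfinitePlace K, ∀ σ x, e σ x = |σ x| := by
  have hinj : Function.Injective (fun σ : K →+* ℝ => Complex.ofRealHom.comp σ) := by
    intro σ τ h
    ext x
    have := congrArg (fun f : K →+* ℂ => f x) h
    simpa using this
  have hbij : Function.Bijective (fun σ : K →+* ℝ => Complex.ofRealHom.comp σ) := by
    rw [Fintype.bijective_iff_injective_and_card]
    exact ⟨hinj, by rw [htot, NumberField.Embeddings.card K ℂ]⟩
  refine ⟨Equiv.ofBijective (fun σ : K →+* ℝ => InfinitePlace.mk (Complex.ofRealHom.comp σ))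
    ⟨?_, ?_⟩, ?_⟩
  · intro σ τ h
    simp only [InfinitePlace.mk_eq_iff] at h
    apply hinj
    rcases h with h | h
    · exact h
    · change Complex.ofRealHom.comp σ = Complex.ofRealHom.comp τ
      rw [← h]
      ext x
      simp [ComplexEmbedding.conjugate]
  · intro w
    obtain ⟨σ, hσ⟩ := hbij.2 w.embedding
    refine ⟨σ, ?_⟩
    simp only at hσ ⊢
    rw [hσ, InfinitePlace.mk_embedding]
  · intro σ x
    change InfinitePlace.mk (Complex.ofRealHom.comp σ) x = |σ x|
    rw [InfinitePlace.apply]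
    simp

lemma isTotallyReal (htot : Fintype.card (K →+* ℝ) = Module.finrank ℚ K) :
    IsTotallyReal K := by
  obtain ⟨e, he⟩ := exists_places_equiv K htot
  refine ⟨fun w => ?_⟩
  obtain ⟨σ, rfl⟩ := e.surjective w
  rw [InfinitePlace.isReal_iff, ComplexEmbedding.isReal_iff]
  have hmk : e σ = InfinitePlace.mk (Complex.ofRealHom.comp σ) := by
    apply InfinitePlace.ext
    intro x
    rw [he]
    simp [InfinitePlace.apply]
  have hre : ComplexEmbedding.IsReal (Complex.ofRealHom.comp σ) := by
    rw [ComplexEmbedding.isReal_iff]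
    ext x
    simp [ComplexEmbedding.conjugate]
  rw [hmk, InfinitePlace.embedding_mk_eq_of_isReal hre]
  exact hre

lemma prod_eq_norm (htot : Fintype.card (K →+* ℝ) = Module.finrank ℚ K) (x : K) :
    ∏ σ : K →+* ℝ, |σ x| = |((Algebra.norm ℚ x : ℚ) : ℝ)| := by
  obtain ⟨e, he⟩ := exists_places_equiv K htot
  have hr := isTotallyReal K htot
  have := InfinitePlace.prod_eq_abs_norm x
  simp only [IsTotallyReal.mult_eq, pow_one] at this
  rw [← Equiv.prod_comp e] at this
  simp only [he] at this
  rw [this]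
  simp

/-- `ε` is a totally positive unit congruent to `1` mod `𝔫`. -/
def Good (𝔫 : Ideal (𝓞 K)) (ε : (𝓞 K)ˣ) : Prop :=
  (∀ σ : K →+* ℝ, 0 < σ (algebraMap (𝓞 K) K ε)) ∧ ((ε : 𝓞 K) - 1) ∈ 𝔫

lemma Good.prod_eq_one (htot : Fintype.card (K →+* ℝ) = Module.finrank ℚ K)
    {𝔫 : Ideal (𝓞 K)} {ε : (𝓞 K)ˣ} (h : Good K 𝔫 ε) :
    ∏ σ : K →+* ℝ, σ (algebraMap (𝓞 K) K ε) = 1 := by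
  have h1 := prod_eq_norm K htot (algebraMap (𝓞 K) K ε)
  have h2 : |((Algebra.norm ℚ (algebraMap (𝓞 K) K ε) : ℚ) : ℝ)| = 1 := by
    have := NumberField.isUnit_iff_norm.mp ε.isUnit
    have h3 : ((|((RingOfIntegers.norm ℚ (ε : 𝓞 K) : 𝓞 ℚ) : ℚ)| : ℚ) : ℝ) = 1 := by
      rw [this]; simp
    rw [Rat.cast_abs] at h3
    exact h3
  rw [h2] at h1
  rw [← h1]
  exact Finset.prod_congr rfl fun σ _ => (abs_of_pos (h.1 σ)).symm

lemma Good.inv {𝔫 : Ideal (𝓞 K)} {ε : (𝓞 K)ˣ} (h : Good K 𝔫 ε) : Good K 𝔫 ε⁻¹ := by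
  refine ⟨fun σ => ?_, ?_⟩
  · have h1 : σ (algebraMap (𝓞 K) K ε) * σ (algebraMap (𝓞 K) K (ε⁻¹ : (𝓞 K)ˣ)) = 1 := by
      rw [← map_mul, ← map_mul]; simp
    have := h.1 σ
    by_contra hc
    nlinarith
  · have : ((ε⁻¹ : (𝓞 K)ˣ) : 𝓞 K) - 1 = -((ε⁻¹ : (𝓞 K)ˣ) : 𝓞 K) * (ε - 1) := by
      have : ((ε⁻¹ : (𝓞 K)ˣ) : 𝓞 K) * ε = 1 := by simp
      linear_combination this
    rw [this]
    exact Ideal.mul_mem_left _ _ h.2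

lemma Good.mul {𝔫 : Ideal (𝓞 K)} {ε η : (𝓞 K)ˣ} (h : Good K 𝔫 ε) (h' : Good K 𝔫 η) :
    Good K 𝔫 (ε * η) := by
  refine ⟨fun σ => ?_, ?_⟩
  · have : σ (algebraMap (𝓞 K) K (ε * η : (𝓞 K)ˣ)) = σ (algebraMap (𝓞 K) K ε) * σ (algebraMap (𝓞 K) K η) := by
      rw [← map_mul, ← map_mul]; simp
    rw [this]
    exact mul_pos (h.1 σ) (h'.1 σ)
  · have : ((ε * η : (𝓞 K)ˣ) : 𝓞 K) - 1 = η * (ε - 1) + (η - 1) := by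
      push_cast; ring
    rw [this]
    exact Ideal.add_mem _ (Ideal.mul_mem_left _ _ h.2) h'.2

lemma exists_pow_good (𝔫 : Ideal (𝓞 K)) (h𝔫 : 𝔫 ≠ ⊥) :
    ∃ N : ℕ, 0 < N ∧ ∀ η : (𝓞 K)ˣ, Good K 𝔫 (η ^ N) := by
  have : Finite (𝓞 K ⧸ 𝔫) := Ideal.finiteQuotientOfFreeOfNeBot 𝔫 h𝔫
  have hfin : Finite (𝓞 K ⧸ 𝔫)ˣ := inferInstance
  refine ⟨Nat.card (𝓞 K ⧸ 𝔫)ˣ * 2, by have := Nat.card_pos (α := (𝓞 K ⧸ 𝔫)ˣ); omega, fun η => ⟨fun σ => ?_, ?_⟩⟩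
  · rw [pow_mul]
    have : σ (algebraMap (𝓞 K) K ((η ^ Nat.card (𝓞 K ⧸ 𝔫)ˣ) ^ 2 : (𝓞 K)ˣ)) =
      (σ (algebraMap (𝓞 K) K (η ^ Nat.card (𝓞 K ⧸ 𝔫)ˣ : (𝓞 K)ˣ))) ^ 2 := by
      rw [← map_pow, ← map_pow]; simp
    rw [this]
    have : σ (algebraMap (𝓞 K) K (η ^ Nat.card (𝓞 K ⧸ 𝔫)ˣ : (𝓞 K)ˣ)) ≠ 0 := by
      rw [map_ne_zero]
      simp
    positivity
  · rw [← Ideal.Quotient.mk_eq_mk_iff_sub_mem, map_one]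
    have h1 : (Units.map (Ideal.Quotient.mk 𝔫).toMonoidHom η) ^ Nat.card (𝓞 K ⧸ 𝔫)ˣ = 1 := pow_card_eq_one'
    have h2 := congrArg (fun u : (𝓞 K ⧸ 𝔫)ˣ => (u : 𝓞 K ⧸ 𝔫)) h1
    simp only [Units.val_pow_eq_pow_val, Units.coe_map, Units.val_one] at h2
    rw [pow_mul]
    push_cast
    rw [map_pow, map_pow]
    erw [h2]
    simp

end EisCT

namespace EisCT

open NumberField.Units NumberField.Units.dirichletUnitTheorem in
lemma exists_near_unit : ∃ B : ℝ, 0 ≤ B ∧ ∀ u : logSpace K, ∃ η : (𝓞 K)ˣ,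
    ∀ w, |u w - logEmbedding K (Additive.ofMul η) w| ≤ B := by
  classical
  let b := (basisUnitLattice K).ofZLatticeBasis ℝ (unitLattice K)
  refine ⟨∑ i, ‖b i‖, by positivity, fun u => ?_⟩
  have hm : (ZSpan.floor b u : logSpace K) ∈ unitLattice K := by
    have h1 := (ZSpan.floor b u).2
    have h2 := (basisUnitLattice K).ofZLatticeBasis_span ℝ (L := unitLattice K)
    rw [← h2]
    exact h1
  obtain ⟨η, -, hη⟩ := hm
  refine ⟨Additive.toMul η, fun w => ?_⟩
  have h3 := ZSpan.norm_fract_le b u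
  refine le_trans ?_ h3
  have h4 := norm_le_pi_norm (ZSpan.fract b u) w
  refine le_trans (le_of_eq ?_) h4
  rw [ZSpan.fract_apply, Pi.sub_apply, ← hη, Real.norm_eq_abs]
  rfl

open NumberField.Units NumberField.Units.dirichletUnitTheorem in
lemma exists_balance (htot : Fintype.card (K →+* ℝ) = Module.finrank ℚ K)
    (𝔫 : Ideal (𝓞 K)) (h𝔫 : 𝔫 ≠ ⊥) :
    ∃ C : ℝ, 0 < C ∧ ∀ q : (K →+* ℝ) → ℝ, (∀ σ, 0 < q σ) → ∃ ε : (𝓞 K)ˣ, Good K 𝔫 ε ∧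
      ∀ σ τ : K →+* ℝ, σ (algebraMap (𝓞 K) K ε) * q σ ≤ C * (τ (algebraMap (𝓞 K) K ε) * q τ) := by
  classical
  have hr := isTotallyReal K htot
  obtain ⟨e, he⟩ := exists_places_equiv K htot
  obtain ⟨N, hN, hgood⟩ := exists_pow_good K 𝔫 h𝔫
  obtain ⟨B, hB, hnear⟩ := exists_near_unit K
  set r : ℝ := (Fintype.card (InfinitePlace K) : ℝ) with hrdef
  have hr1 : 1 ≤ r := by
    rw [hrdef]
    exact_mod_cast Fintype.card_pos
  have hN' : (0 : ℝ) < N := by exact_mod_cast hN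
  refine ⟨Real.exp (2 * (r * (N * B))), Real.exp_pos _, fun q hq => ?_⟩
  set p : InfinitePlace K → ℝ := fun w => Real.log (q (e.symm w)) with hp
  set Q : ℝ := (∑ w, p w) / r with hQ
  obtain ⟨η, hη⟩ := hnear (fun w => (Q - p w) / N)
  refine ⟨η ^ N, hgood η, ?_⟩
  set f : InfinitePlace K → ℝ := fun w => N * Real.log (w (η : K)) + p w - Q with hf
  have hsum : ∑ w, f w = 0 := by
    simp only [hf, Finset.sum_sub_distrib, Finset.sum_add_distrib, ← Finset.mul_sum]
    have h := sum_mult_mul_log η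
    simp only [IsTotallyReal.mult_eq, Nat.cast_one, one_mul] at h
    rw [h]
    simp only [Finset.sum_const, Finset.card_univ, nsmul_eq_mul, hQ, ← hrdef]
    field_simp
    ring
  have hf1 : ∀ w, w ≠ w₀ → |f w| ≤ N * B := by
    intro w hw
    have h := hη ⟨w, hw⟩
    rw [logEmbedding_component] at h
    simp only [IsTotallyReal.mult_eq, Nat.cast_one, one_mul] at h
    have h5 : f w = -(N * ((Q - p w) / N - Real.log (w (η : K)))) := by
      simp only [hf]
      field_simp
      ring
    rw [h5, abs_neg, abs_mul, abs_of_pos hN']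
    gcongr
  have hNB : 0 ≤ N * B := by positivity
  have hf2 : ∀ w, |f w| ≤ r * (N * B) := by
    intro w
    by_cases hw : w = w₀
    · subst hw
      have h6 : f w₀ = -∑ w ∈ Finset.univ.erase w₀, f w := by
        have := Finset.add_sum_erase Finset.univ f (Finset.mem_univ w₀)
        rw [hsum] at this
        linarith
      rw [h6, abs_neg]
      refine (Finset.abs_sum_le_sum_abs _ _).trans ?_
      refine (Finset.sum_le_card_nsmul _ _ (N * B) ?_).trans ?_
      · intro w hw
        exact hf1 w (Finset.ne_of_mem_erase hw)
      · rw [nsmul_eq_mul]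
        gcongr
        rw [hrdef]
        exact_mod_cast (Finset.card_le_univ _)
    · exact (hf1 w hw).trans (by nlinarith)
  have key : ∀ σ : K →+* ℝ, σ (algebraMap (𝓞 K) K (η ^ N : (𝓞 K)ˣ)) * q σ
      = Real.exp (f (e σ) + Q) := by
    intro σ
    have h7 := (hgood η).1 σ
    have h8 : σ (algebraMap (𝓞 K) K (η ^ N : (𝓞 K)ˣ)) = (e σ (η : K)) ^ N := by
      rw [← abs_of_pos h7, he]
      simp
    have h9 : 0 < e σ (η : K) := by
      rw [InfinitePlace.pos_iff]
      simp
    simp only [hf, hp, Equiv.symm_apply_apply, sub_add_cancel]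
    rw [Real.exp_add, Real.exp_log (hq σ), h8, mul_comm (N : ℝ), Real.exp_mul, Real.exp_log h9]
    simp
  intro σ τ
  rw [key, key, ← Real.exp_add]
  apply Real.exp_le_exp.mpr
  have h10 := abs_le.mp (hf2 (e σ))
  have h11 := abs_le.mp (hf2 (e τ))
  linarith

end EisCT

namespace EisCT

/-- Sup norm of the vector of real conjugates. -/
noncomputable def sz (x : K) : ℝ := ‖(fun σ : K →+* ℝ => σ x)‖

lemma sz_nonneg (x : K) : 0 ≤ sz K x := norm_nonneg _

lemma le_sz (x : K) (σ : K →+* ℝ) : |σ x| ≤ sz K x :=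
  norm_le_pi_norm (fun σ : K →+* ℝ => σ x) σ

lemma sz_le {x : K} {B : ℝ} (hB : 0 ≤ B) (h : ∀ σ : K →+* ℝ, |σ x| ≤ B) : sz K x ≤ B :=
  (pi_norm_le_iff_of_nonneg hB).mpr h

open scoped Classical in
lemma norm_mixed_le (htot : Fintype.card (K →+* ℝ) = Module.finrank ℚ K) (x : K) :
    ‖mixedEmbedding K x‖ ≤ sz K x := by
  classical
  obtain ⟨e, he⟩ := exists_places_equiv K htot
  rw [mixedEmbedding.norm_eq_sup'_normAtPlace]
  apply Finset.sup'_le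
  intro w _
  rw [mixedEmbedding.normAtPlace_apply]
  obtain ⟨σ, rfl⟩ := e.surjective w
  rw [he]
  exact le_sz K x σ

open scoped Classical in
lemma summable_ints (htot : Fintype.card (K →+* ℝ) = Module.finrank ℚ K)
    (s : ℝ) (hs : (Module.finrank ℚ K : ℝ) < s) :
    Summable (fun x : 𝓞 K => (max 1 (sz K (x : K))) ^ (-s)) := by
  have hs0 : 0 < s := lt_of_le_of_lt (Nat.cast_nonneg _) hs
  have h1 := ZLattice.summable_norm_rpow (mixedEmbedding.integerLattice K) (-s) (by
    have : Module.finrank ℤ (mixedEmbedding.integerLattice K) = Module.finrank ℚ K := by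
      rw [ZLattice.rank ℝ, mixedEmbedding.finrank]
    rw [this]
    linarith)
  let g : 𝓞 K → mixedEmbedding.integerLattice K := fun x => ⟨mixedEmbedding K x, ⟨x, by simp⟩⟩
  have hg : Function.Injective g := by
    intro x y h
    have h2 := congrArg Subtype.val h
    have h3 := (mixedEmbedding_injective K) h2
    exact RingOfIntegers.ext h3
  have h2 := h1.comp_injective hg
  refine Summable.of_norm_bounded_eventually (g := fun x => ‖g x‖ ^ (-s)) h2 ?_
  have hfin : ({0}ᶜ : Set (𝓞 K)) ∈ Filter.cofinite := by simp
  filter_upwards [hfin] with x hx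
  have hx0 : x ≠ 0 := by simpa using hx
  have hg0 : 0 < ‖g x‖ := by
    rw [norm_pos_iff]
    intro h
    apply hx0
    apply hg
    rw [h]
    apply Subtype.ext
    simp [g]
  rw [Real.norm_of_nonneg (by positivity)]
  apply Real.rpow_le_rpow_of_nonpos hg0 _ (by linarith)
  exact (norm_mixed_le K htot x).trans (le_max_right _ _)

lemma one_le_sz (htot : Fintype.card (K →+* ℝ) = Module.finrank ℚ K) (x : 𝓞 K) (hx : x ≠ 0) :
    1 ≤ sz K (x : K) := by
  have h1 := prod_eq_norm K htot (x : K)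
  have h2 : (1 : ℝ) ≤ |((Algebra.norm ℚ (x : K) : ℚ) : ℝ)| := by
    have h3 : Algebra.norm ℤ x ≠ 0 := by
      rw [Algebra.norm_ne_zero_iff]; exact hx
    have h4 : (Algebra.norm ℚ (x : K) : ℚ) = (Algebra.norm ℤ x : ℤ) :=
      (Algebra.coe_norm_int x).symm
    rw [h4]
    have h5 := Int.one_le_abs h3
    push_cast
    exact_mod_cast h5
  by_contra hc
  push Not at hc
  have hne : Nonempty (K →+* ℝ) := by
    rw [← Fintype.card_pos_iff, htot]
    exact Module.finrank_pos
  have h6 : ∏ σ : K →+* ℝ, |σ (x : K)| < ∏ σ : K →+* ℝ, (1 : ℝ) := by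
    apply Finset.prod_lt_prod_of_nonempty
    · intro σ _
      rw [abs_pos, map_ne_zero]
      simpa using hx
    · intro σ _
      exact lt_of_le_of_lt (le_sz K _ σ) hc
    · exact Finset.univ_nonempty
  rw [h1] at h6
  simp at h6
  linarith

lemma summable_pairs (htot : Fintype.card (K →+* ℝ) = Module.finrank ℚ K)
    (s : ℝ) (hs : 2 * (Module.finrank ℚ K : ℝ) < s) :
    Summable (fun v : 𝓞 K × 𝓞 K => (max 1 (max (sz K (v.1 : K)) (sz K (v.2 : K)))) ^ (-s)) := by
  have hs0 : 0 < s := lt_of_le_of_lt (by positivity) hs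
  have h1 := summable_ints K htot (s / 2) (by linarith)
  have h2 := h1.mul_of_nonneg h1 (fun _ => by positivity) (fun _ => by positivity)
  refine Summable.of_nonneg_of_le (fun _ => by positivity) ?_ h2
  rintro ⟨x, y⟩
  simp only
  have h3 : (max 1 (max (sz K (x : K)) (sz K (y : K)))) ^ (-s)
    = (max 1 (max (sz K (x : K)) (sz K (y : K)))) ^ (-(s/2)) * (max 1 (max (sz K (x : K)) (sz K (y : K)))) ^ (-(s/2)) := by
    rw [← Real.rpow_add (by positivity)]
    congr 1
    ring
  rw [h3]
  gcongr ?_ * ?_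
  · apply Real.rpow_le_rpow_of_nonpos (by positivity) _ (by linarith)
    exact max_le_max le_rfl (le_max_left _ _)
  · apply Real.rpow_le_rpow_of_nonpos (by positivity) _ (by linarith)
    exact max_le_max le_rfl (le_max_right _ _)

end EisCT

namespace EisCT

lemma summable_reps (htot : Fintype.card (K →+* ℝ) = Module.finrank ℚ K)
    (𝔫 : Ideal (𝓞 K)) (h𝔫 : 𝔫 ≠ ⊥) (k : ℕ) (hk : 3 ≤ k) {T : Type*} (v : T → K × K)
    (D : 𝓞 K) (hD : D ≠ 0)
    (hint : ∀ t, (∃ x : 𝓞 K, (x : K) = D * (v t).1) ∧ (∃ y : 𝓞 K, (y : K) = D * (v t).2))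
    (hne : ∀ t, v t ≠ 0)
    (hinj : ∀ t s, ∀ ε : (𝓞 K)ˣ, Good K 𝔫 ε → (v t).1 = (ε : K) * (v s).1 →
      (v t).2 = (ε : K) * (v s).2 → t = s) :
    Summable (fun t => ((∏ σ : K →+* ℝ, max |σ (v t).1| |σ (v t).2|)⁻¹) ^ k) := by
  obtain ⟨C, hC, hbal⟩ := exists_balance K htot 𝔫 h𝔫
  have hq : ∀ t, ∀ σ : K →+* ℝ, 0 < max |σ (v t).1| |σ (v t).2| := by
    intro t σ
    by_contra hc
    push Not at hc
    have h1 := (le_max_left _ _).trans hc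
    have h2 := (le_max_right _ _).trans hc
    apply hne t
    apply Prod.ext
    · simpa using h1
    · simpa using h2
  choose ε hgood hε using fun t => hbal (fun σ => max |σ (v t).1| |σ (v t).2|) (hq t)
  choose hx hy using hint
  choose x hx using hx
  choose y hy using hy
  have hDK : (D : K) ≠ 0 := by simpa using hD
  let φ : T → 𝓞 K × 𝓞 K := fun t => (ε t * x t, ε t * y t)
  have hφ1 : ∀ t, ((φ t).1 : K) = ε t * (D * (v t).1) := by
    intro t
    simp [φ, hx]
  have hφ2 : ∀ t, ((φ t).2 : K) = ε t * (D * (v t).2) := by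
    intro t
    simp [φ, hy]
  have hφ : Function.Injective φ := by
    intro t s h
    have h1 := congrArg (fun z : 𝓞 K × 𝓞 K => (z.1 : K)) h
    have h2 := congrArg (fun z : 𝓞 K × 𝓞 K => (z.2 : K)) h
    simp only [hφ1, hφ2] at h1 h2
    have h0 : (((ε t)⁻¹ : (𝓞 K)ˣ) : K) * (ε t : K) = 1 := by
      rw [← map_mul]; simp
    refine hinj t s ((ε t)⁻¹ * ε s) ((hgood t).inv.mul K (hgood s)) ?_ ?_
    · apply mul_left_cancel₀ hDK
      rw [Units.val_mul, map_mul]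
      linear_combination (((ε t)⁻¹ : (𝓞 K)ˣ) : K) * h1 - D * (v t).1 * h0
    · apply mul_left_cancel₀ hDK
      rw [Units.val_mul, map_mul]
      linear_combination (((ε t)⁻¹ : (𝓞 K)ˣ) : K) * h2 - D * (v t).2 * h0
  set r := Module.finrank ℚ K with hr
  have hrpos : 0 < r := Module.finrank_pos
  have h1 := (summable_pairs K htot ((r * k : ℕ) : ℝ) (by
    have h3 : 2 * r < r * k := by nlinarith
    exact_mod_cast h3)).comp_injective hφ
  obtain ⟨A, hA⟩ : ∃ A : ℝ, A = sz K (D : K) * C := ⟨_, rfl⟩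
  have hDs : 0 < sz K (D : K) := lt_of_lt_of_le one_pos (one_le_sz K htot D hD)
  have hApos : 0 < A := by rw [hA]; positivity
  refine Summable.of_nonneg_of_le ?_ ?_ (h1.mul_left (A ^ (r * k)))
  · intro t
    have : 0 ≤ ∏ σ : K →+* ℝ, max |σ (v t).1| |σ (v t).2| :=
      Finset.prod_nonneg fun σ _ => (hq t σ).le
    positivity
  · intro t
    simp only [Function.comp]
    set M := max (sz K ((φ t).1 : K)) (sz K ((φ t).2 : K)) with hM
    have hM1 : 1 ≤ M := by
      by_cases h : (φ t).1 = 0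
      · have h' : (φ t).2 ≠ 0 := by
          intro h'
          have e1 := hφ1 t
          have e2 := hφ2 t
          rw [h] at e1
          rw [h'] at e2
          apply hne t
          apply Prod.ext
          · simpa [hD] using e1.symm
          · simpa [hD] using e2.symm
        exact (one_le_sz K htot _ h').trans (le_max_right _ _)
      · exact (one_le_sz K htot _ h).trans (le_max_left _ _)
    have hMle : ∀ τ : K →+* ℝ, M ≤ A * (τ (algebraMap (𝓞 K) K (ε t)) * max |τ (v t).1| |τ (v t).2|) := by
      intro τ
      have hpos : 0 < τ (algebraMap (𝓞 K) K (ε t)) * max |τ (v t).1| |τ (v t).2| :=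
        mul_pos ((hgood t).1 τ) (hq t τ)
      have hstep : ∀ (σ : K →+* ℝ) (z : K), |σ z| ≤ max |σ (v t).1| |σ (v t).2| →
          |σ ((ε t : K) * (D * z))| ≤
            A * (τ (algebraMap (𝓞 K) K (ε t)) * max |τ (v t).1| |τ (v t).2|) := by
        intro σ z hz
        have h5 := hε t σ τ
        have h6 := (hgood t).1 σ
        have h7 := le_sz K (D : K) σ
        calc |σ ((ε t : K) * (D * z))| = |σ (D : K)| * (σ (ε t : K) * |σ z|) := by
              rw [map_mul, map_mul, abs_mul, abs_mul, abs_of_pos h6]; ring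
          _ ≤ sz K (D : K) * (σ (ε t : K) * max |σ (v t).1| |σ (v t).2|) := by gcongr
          _ ≤ sz K (D : K) * (C * (τ (algebraMap (𝓞 K) K (ε t)) * max |τ (v t).1| |τ (v t).2|)) := by
              gcongr
          _ = _ := by rw [hA]; ring
      apply max_le
      · apply sz_le K (by positivity)
        intro σ
        rw [hφ1]
        exact hstep σ _ (le_max_left _ _)
      · apply sz_le K (by positivity)
        intro σ
        rw [hφ2]
        exact hstep σ _ (le_max_right _ _)
    set Q := ∏ σ : K →+* ℝ, max |σ (v t).1| |σ (v t).2| with hQ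
    have hQpos : 0 < Q := Finset.prod_pos fun σ _ => hq t σ
    have hMr : M ^ r ≤ A ^ r * Q := by
      calc M ^ r = ∏ τ : K →+* ℝ, M := by rw [Finset.prod_const, Finset.card_univ, htot]
        _ ≤ ∏ τ : K →+* ℝ, (A * (τ (algebraMap (𝓞 K) K (ε t)) * max |τ (v t).1| |τ (v t).2|)) :=
            Finset.prod_le_prod (fun _ _ => by linarith) (fun τ _ => hMle τ)
        _ = A ^ r * Q := by
            rw [Finset.prod_mul_distrib, Finset.prod_mul_distrib, (hgood t).prod_eq_one K htot,
              Finset.prod_const, Finset.card_univ, htot, one_mul]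
    rw [max_eq_right hM1, Real.rpow_neg (by linarith), Real.rpow_natCast, pow_mul, pow_mul,
      inv_pow, ← div_eq_mul_inv, le_div_iff₀ (by positivity), inv_mul_le_iff₀ (by positivity)]
    calc (M ^ r) ^ k ≤ (A ^ r * Q) ^ k := by gcongr
      _ = _ := by ring

open UniqueFactorizationMonoid in
lemma moebius_sum (𝔫 J : Ideal (𝓞 K)) (hJ : J ≠ ⊥) (hJn : J ⊔ 𝔫 = ⊤) [Decidable (J = ⊤)] :
    ∑' 𝔱 : {𝔱 : Ideal (𝓞 K) // 𝔱 ∣ J ∧ 𝔱 ⊔ 𝔫 = ⊤}, (idealMoebius K 𝔱.1 : ℂ) =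
      if J = ⊤ then 1 else 0 := by
  classical
  set P : Finset (Ideal (𝓞 K)) := (normalizedFactors J).toFinset with hP
  have hprime : ∀ s ∈ P.powerset, ∀ p ∈ s.val, Prime p := by
    intro s hs p hp
    have : p ∈ normalizedFactors J := by
      exact Multiset.mem_toFinset.mp ((Finset.mem_powerset.mp hs) hp)
    exact prime_of_normalized_factor p this
  have hnf : ∀ s ∈ P.powerset, normalizedFactors s.val.prod = s.val := fun s hs =>
    normalizedFactors_prod_of_prime (hprime s hs)
  have hne0 : ∀ s ∈ P.powerset, s.val.prod ≠ 0 := by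
    intro s hs h
    rw [Multiset.prod_eq_zero_iff] at h
    exact (hprime s hs 0 h).ne_zero rfl
  have hdvd : ∀ s ∈ P.powerset, s.val.prod ∣ J := by
    intro s hs
    rw [dvd_iff_normalizedFactors_le_normalizedFactors (hne0 s hs) hJ, hnf s hs,
      Multiset.le_iff_subset s.nodup]
    intro p hp
    exact Multiset.mem_toFinset.mp ((Finset.mem_powerset.mp hs) hp)
  have hcop : ∀ 𝔱 : Ideal (𝓞 K), 𝔱 ∣ J → 𝔱 ⊔ 𝔫 = ⊤ := by
    intro 𝔱 h
    rw [eq_top_iff, ← hJn]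
    exact sup_le_sup_right (Ideal.le_of_dvd h) _
  let g : P.powerset → {𝔱 : Ideal (𝓞 K) // 𝔱 ∣ J ∧ 𝔱 ⊔ 𝔫 = ⊤} :=
    fun s => ⟨s.1.val.prod, hdvd s.1 s.2, hcop _ (hdvd s.1 s.2)⟩
  have hg : Function.Injective g := by
    intro s s' h
    have h1 := congrArg (fun 𝔱 => normalizedFactors 𝔱.1) h
    simp only [g, hnf s.1 s.2, hnf s'.1 s'.2] at h1
    exact Subtype.ext (Finset.val_injective h1)
  have hsupp : Function.support
      (fun 𝔱 : {𝔱 : Ideal (𝓞 K) // 𝔱 ∣ J ∧ 𝔱 ⊔ 𝔫 = ⊤} => (idealMoebius K 𝔱.1 : ℂ)) ⊆ Set.range g := by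
    rintro ⟨𝔱, hd, hc⟩ h
    have hsq : Squarefree 𝔱 := by
      by_contra hn
      simp [idealMoebius, hn] at h
    have h0 : 𝔱 ≠ 0 := hsq.ne_zero
    have hnd := (squarefree_iff_nodup_normalizedFactors h0).mp hsq
    refine ⟨⟨⟨normalizedFactors 𝔱, hnd⟩, ?_⟩, ?_⟩
    · rw [Finset.mem_powerset]
      intro p hp
      rw [hP, Multiset.mem_toFinset]
      exact Multiset.mem_of_le ((dvd_iff_normalizedFactors_le_normalizedFactors h0 hJ).mp hd) hp
    · apply Subtype.ext
      exact Ideal.prod_normalizedFactors_eq_self h0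
  rw [← hg.tsum_eq hsupp]
  have hval : ∀ s : P.powerset, (idealMoebius K (g s).1 : ℂ) = (((-1) ^ s.1.card : ℤ) : ℂ) := by
    intro s
    have hsq : Squarefree (g s).1 := by
      rw [squarefree_iff_nodup_normalizedFactors (hne0 s.1 s.2)]
      rw [hnf s.1 s.2]
      exact s.1.nodup
    rw [idealMoebius, if_pos hsq]
    change (((-1) ^ (normalizedFactors s.1.val.prod).card : ℤ) : ℂ) = _
    rw [hnf s.1 s.2]
    rfl
  simp only [hval]
  rw [Finset.tsum_subtype P.powerset (fun s => (((-1) ^ s.card : ℤ) : ℂ)), ← Int.cast_sum,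
    Finset.sum_powerset_neg_one_pow_card]
  have hiff : P = ∅ ↔ J = ⊤ := by
    rw [hP, Multiset.toFinset_eq_empty, ← Ideal.one_eq_top]
    constructor
    · intro h
      rw [← Ideal.prod_normalizedFactors_eq_self hJ, h, Multiset.prod_zero]
    · intro h
      rw [h, normalizedFactors_one]
  by_cases h : J = ⊤ <;> simp [h, hiff]

end EisCT

namespace EisCT

open FractionalIdeal

lemma span_le_four (a b c d : FractionalIdeal (𝓞 K)⁰ K) :
    a ≤ a + b + c + d ∧ b ≤ a + b + c + d ∧ c ≤ a + b + c + d ∧ d ≤ a + b + c + d := by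
  simp only [← sup_eq_add]
  exact ⟨le_sup_of_le_left (le_sup_of_le_left le_sup_left),
    le_sup_of_le_left (le_sup_of_le_left le_sup_right), le_sup_of_le_left le_sup_right,
    le_sup_right⟩

lemma mem_mul_inv_iff {α₃ α₄ : K} {𝔟 : FractionalIdeal (𝓞 K)⁰ K}
    (h𝔟 : 𝔟 = spanSingleton (𝓞 K)⁰ α₃ + spanSingleton (𝓞 K)⁰ α₄) (h𝔟0 : 𝔟 ≠ 0)
    (I : FractionalIdeal (𝓞 K)⁰ K) (l : K) :
    l ∈ I * 𝔟⁻¹ ↔ α₃ * l ∈ I ∧ α₄ * l ∈ I := by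
  rw [← spanSingleton_le_iff_mem, le_mul_inv_iff₀ (bot_lt_iff_ne_bot.mpr h𝔟0), h𝔟, mul_add,
    spanSingleton_mul_spanSingleton, spanSingleton_mul_spanSingleton, ← sup_eq_add, sup_le_iff,
    spanSingleton_le_iff_mem, spanSingleton_le_iff_mem, mul_comm l, mul_comm l]

lemma span_pair_eq {α₃ α₄ : K} {𝔟 : FractionalIdeal (𝓞 K)⁰ K}
    (h𝔟 : 𝔟 = spanSingleton (𝓞 K)⁰ α₃ + spanSingleton (𝓞 K)⁰ α₄) (l : K) :
    spanSingleton (𝓞 K)⁰ (α₃ * l) + spanSingleton (𝓞 K)⁰ (α₄ * l)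
      = spanSingleton (𝓞 K)⁰ l * 𝔟 := by
  rw [h𝔟, mul_add, spanSingleton_mul_spanSingleton, spanSingleton_mul_spanSingleton, mul_comm l,
    mul_comm l]

lemma span_unit_mul (ε : (𝓞 K)ˣ) (l : K) :
    spanSingleton (𝓞 K)⁰ (algebraMap (𝓞 K) K ε * l) = spanSingleton (𝓞 K)⁰ l := by
  rw [← spanSingleton_mul_spanSingleton, ← coeIdeal_span_singleton,
    Ideal.span_singleton_eq_top.mpr ε.isUnit]
  simp

lemma J_eq_top_iff {𝔞 𝔟 : FractionalIdeal (𝓞 K)⁰ K} (h𝔞 : 𝔞 ≠ 0) {J : Ideal (𝓞 K)} {l : K}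
    (hJ : (J : FractionalIdeal (𝓞 K)⁰ K) = spanSingleton (𝓞 K)⁰ l * 𝔞⁻¹ * 𝔟) :
    J = ⊤ ↔ spanSingleton (𝓞 K)⁰ l * 𝔟 = 𝔞 := by
  have h1 : (J : FractionalIdeal (𝓞 K)⁰ K) * 𝔞 = spanSingleton (𝓞 K)⁰ l * 𝔟 := by
    rw [hJ]
    calc _ = spanSingleton (𝓞 K)⁰ l * 𝔟 * (𝔞⁻¹ * 𝔞) := by ring
      _ = _ := by rw [inv_mul_cancel₀ h𝔞, mul_one]
  rw [← h1, ← Ideal.one_eq_top, ← coeIdeal_eq_one (K := K)]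
  constructor
  · intro h
    rw [h, one_mul]
  · intro h
    exact mul_right_cancel₀ h𝔞 (by rw [h, one_mul])

lemma J_sup_eq_top {α₃ α₄ : K} {𝔞 𝔟 : FractionalIdeal (𝓞 K)⁰ K} (h𝔞 : 𝔞 ≠ 0)
    (h𝔟 : 𝔟 = spanSingleton (𝓞 K)⁰ α₃ + spanSingleton (𝓞 K)⁰ α₄) (h𝔟0 : 𝔟 ≠ 0)
    {𝔫 J I₂ : Ideal (𝓞 K)} {l a₂ a₂star : K}
    (hI₂ : (I₂ : FractionalIdeal (𝓞 K)⁰ K) = spanSingleton (𝓞 K)⁰ a₂ * 𝔞⁻¹)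
    (hI₂𝔫 : I₂ ⊔ 𝔫 = ⊤)
    (ha₂star₂ : α₄ * a₂star - a₂ ∈ (𝔫 : FractionalIdeal (𝓞 K)⁰ K) * 𝔞)
    (hl : l - a₂star ∈ (𝔫 : FractionalIdeal (𝓞 K)⁰ K) * (𝔞 * 𝔟⁻¹))
    (hJ : (J : FractionalIdeal (𝓞 K)⁰ K) = spanSingleton (𝓞 K)⁰ l * 𝔞⁻¹ * 𝔟) :
    J ⊔ 𝔫 = ⊤ := by
  rw [← mul_assoc, mem_mul_inv_iff K h𝔟 h𝔟0] at hl
  have h1 : a₂ ∈ spanSingleton (𝓞 K)⁰ l * 𝔟 + (𝔫 : FractionalIdeal (𝓞 K)⁰ K) * 𝔞 := by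
    have e : a₂ = l * α₄ + (-(α₄ * (l - a₂star)) + -(α₄ * a₂star - a₂)) := by ring
    rw [e]
    have m1 : l * α₄ ∈ spanSingleton (𝓞 K)⁰ l * 𝔟 := by
      apply mul_mem_mul
      · exact mem_spanSingleton_self _ _
      · rw [h𝔟, ← sup_eq_add, ← spanSingleton_le_iff_mem]
        exact le_sup_right
    have m2 : (-(α₄ * (l - a₂star)) + -(α₄ * a₂star - a₂)) ∈ (𝔫 : FractionalIdeal (𝓞 K)⁰ K) * 𝔞 := by
      rw [← mem_coe]
      exact Submodule.add_mem _ (Submodule.neg_mem _ hl.2) (Submodule.neg_mem _ ha₂star₂)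
    rw [← mem_coe, coe_add]
    exact Submodule.add_mem_sup m1 m2
  rw [← spanSingleton_le_iff_mem] at h1
  have h2 : (I₂ : FractionalIdeal (𝓞 K)⁰ K) ≤ ((J ⊔ 𝔫 : Ideal (𝓞 K)) : FractionalIdeal (𝓞 K)⁰ K) := by
    rw [hI₂, coeIdeal_sup, hJ]
    calc _ ≤ (spanSingleton (𝓞 K)⁰ l * 𝔟 + (𝔫 : FractionalIdeal (𝓞 K)⁰ K) * 𝔞) * 𝔞⁻¹ :=
          mul_le_mul_left h1 _
      _ = spanSingleton (𝓞 K)⁰ l * 𝔞⁻¹ * 𝔟 + (𝔫 : FractionalIdeal (𝓞 K)⁰ K) * (𝔞 * 𝔞⁻¹) := by ring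
      _ = _ := by rw [mul_inv_cancel₀ h𝔞, mul_one]
  have h3 : I₂ ≤ J ⊔ 𝔫 := (coeIdeal_le_coeIdeal K).mp h2
  rw [eq_top_iff, ← hI₂𝔫]
  exact sup_le h3 le_sup_right

/-- Right multiplication by the inverse matrix. -/
def cd (α₁ α₂ α₃ α₄ : K) (v : K × K) : K × K := (v.1 * α₄ - v.2 * α₃, v.2 * α₁ - v.1 * α₂)

lemma cd_inv {α₁ α₂ α₃ α₄ : K} (hdet : α₁ * α₄ - α₂ * α₃ = 1) (v : K × K) :
    v.1 = (cd K α₁ α₂ α₃ α₄ v).1 * α₁ + (cd K α₁ α₂ α₃ α₄ v).2 * α₃ ∧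
    v.2 = (cd K α₁ α₂ α₃ α₄ v).1 * α₂ + (cd K α₁ α₂ α₃ α₄ v).2 * α₄ := by
  simp only [cd]
  constructor
  · linear_combination -v.1 * hdet
  · linear_combination -v.2 * hdet

lemma slash_term {α₁ α₂ α₃ α₄ : K} (hdet : α₁ * α₄ - α₂ * α₃ = 1)
    (𝔞 : FractionalIdeal (𝓞 K)⁰ K) (k : ℕ) (t : ℝ) (ht : 0 < t) (v : K × K) :
    (∏ σ : K →+* ℝ,
            ((σ α₃ : ℂ) * matInvSMul K α₁ α₂ α₃ α₄ (fun _ => Complex.I * t) σ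
              + (σ α₄ : ℂ)) ^ k) *
      eisTerm K 𝔞 k (matInvSMul K α₁ α₂ α₃ α₄ (fun _ => Complex.I * t)) v =
      eisTerm K 𝔞 k (fun _ => Complex.I * t) (cd K α₁ α₂ α₃ α₄ v) := by
  have hden : ∀ σ : K →+* ℝ, (-(σ α₃ : ℂ) * (Complex.I * t) + (σ α₁ : ℂ)) ≠ 0 := by
    intro σ h
    have h1 := congrArg Complex.re h
    have h2 := congrArg Complex.im h
    simp at h1 h2
    have h3 := congrArg σ hdet
    simp only [map_sub, map_mul, map_one] at h3
    have h4 : σ α₃ = 0 := by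
      rcases h2 with h2 | h2
      · simpa using h2
      · exact absurd h2 ht.ne'
    have h5 : σ α₁ = 0 := by simpa using h1
    rw [h4, h5] at h3
    simp at h3
  have hdetσ : ∀ σ : K →+* ℝ, (σ α₁ : ℂ) * σ α₄ - σ α₂ * σ α₃ = 1 := by
    intro σ
    have h3 := congrArg σ hdet
    simp only [map_sub, map_mul, map_one] at h3
    exact_mod_cast h3
  have e1 : ∀ σ : K →+* ℝ, (σ α₃ : ℂ) * matInvSMul K α₁ α₂ α₃ α₄ (fun _ => Complex.I * t) σ
              + (σ α₄ : ℂ) = (-(σ α₃ : ℂ) * (Complex.I * t) + (σ α₁ : ℂ))⁻¹ := by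
    intro σ
    have hd := hden σ
    simp only [matInvSMul]
    rw [mul_div_assoc', div_add' _ _ _ hd, inv_eq_one_div, div_left_inj' hd]
    linear_combination hdetσ σ
  have e2 : ∀ σ : K →+* ℝ, (σ v.1 : ℂ) * matInvSMul K α₁ α₂ α₃ α₄ (fun _ => Complex.I * t) σ
              + (σ v.2 : ℂ) = ((σ (cd K α₁ α₂ α₃ α₄ v).1 : ℂ) * (Complex.I * t) +
                (σ (cd K α₁ α₂ α₃ α₄ v).2 : ℂ)) *
                (-(σ α₃ : ℂ) * (Complex.I * t) + (σ α₁ : ℂ))⁻¹ := by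
    intro σ
    have hd := hden σ
    simp only [matInvSMul, cd, map_sub, map_mul]
    rw [mul_div_assoc', div_add' _ _ _ hd, ← div_eq_mul_inv, div_left_inj' hd]
    push_cast
    ring
  simp only [eisTerm, e1, e2, mul_pow, Finset.prod_mul_distrib]
  have hP : ∏ σ : K →+* ℝ, ((-(σ α₃ : ℂ) * (Complex.I * t) + (σ α₁ : ℂ))⁻¹) ^ k ≠ 0 :=
    Finset.prod_ne_zero_iff.mpr fun σ _ => pow_ne_zero _ (inv_ne_zero (hden σ))
  rw [mul_comm, div_mul_eq_mul_div, mul_div_mul_right _ _ hP]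

lemma norm_eisTerm_le (𝔞 : FractionalIdeal (𝓞 K)⁰ K) (k : ℕ) (t : ℝ) (ht : 1 ≤ t) (v : K × K)
    (hv : v ≠ 0) :
    ‖eisTerm K 𝔞 k (fun _ => Complex.I * t) v‖ ≤
      ‖(FractionalIdeal.absNorm 𝔞 : ℂ) ^ k‖ * ((∏ σ : K →+* ℝ, max |σ v.1| |σ v.2|)⁻¹) ^ k := by
  have hq : ∀ σ : K →+* ℝ, 0 < max |σ v.1| |σ v.2| := by
    intro σ
    by_contra hc
    push Not at hc
    have h1 := (le_max_left _ _).trans hc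
    have h2 := (le_max_right _ _).trans hc
    apply hv
    apply Prod.ext
    · simpa using h1
    · simpa using h2
  rw [eisTerm, norm_div, div_eq_mul_inv, inv_pow, ← Finset.prod_pow, norm_prod]
  gcongr with σ _
  · exact Finset.prod_pos fun σ _ => pow_pos (hq σ) k
  · rw [norm_pow]
    have := (hq σ).le
    gcongr
    apply max_le
    · refine le_trans ?_ (Complex.abs_im_le_norm _)
      simp [abs_mul]
      exact le_mul_of_one_le_right (abs_nonneg _) (ht.trans (le_abs_self t))
    · refine le_trans ?_ (Complex.abs_re_le_norm _)
      simp

open scoped Classical in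
lemma tendsto_eisTerm (hne : Nonempty (K →+* ℝ)) (𝔞 : FractionalIdeal (𝓞 K)⁰ K)
    (k : ℕ) (hk : 3 ≤ k) (v : K × K) :
    Filter.Tendsto (fun t : ℝ => eisTerm K 𝔞 k (fun _ => Complex.I * t) v) Filter.atTop
      (nhds (if v.1 = 0 then
        (FractionalIdeal.absNorm 𝔞 : ℂ) ^ k / ((∏ σ : K →+* ℝ, (σ v.2 : ℂ)) ^ k) else 0)) := by
  split_ifs with h
  · have : (fun t : ℝ => eisTerm K 𝔞 k (fun _ => Complex.I * t) v) = fun _ =>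
        (FractionalIdeal.absNorm 𝔞 : ℂ) ^ k / ((∏ σ : K →+* ℝ, (σ v.2 : ℂ)) ^ k) := by
      funext t
      simp [eisTerm, h, Finset.prod_pow]
    rw [this]
    exact tendsto_const_nhds
  · have h1 : ∀ σ : K →+* ℝ, Filter.Tendsto
        (fun t : ℝ => ((((σ v.1 : ℂ) * (Complex.I * t) + (σ v.2 : ℂ)) ^ k)⁻¹ : ℂ)) Filter.atTop (nhds 0) := by
      intro σ
      have hσ : 0 < |σ v.1| := by
        rw [abs_pos, _root_.map_ne_zero]
        exact h
      have h2 : Filter.Tendsto (fun t : ℝ => ‖(σ v.1 : ℂ) * (Complex.I * t) + (σ v.2 : ℂ)‖)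
          Filter.atTop Filter.atTop := by
        apply Filter.tendsto_atTop_mono (f := fun t : ℝ => |σ v.1| * t)
        · intro t
          refine le_trans ?_ (Complex.abs_im_le_norm _)
          simp [abs_mul]
          exact mul_le_mul_of_nonneg_left (le_abs_self t) (abs_nonneg _)
        · exact Filter.tendsto_id.const_mul_atTop hσ
      have h3 := (Filter.tendsto_pow_atTop (α := ℝ) (n := k) (by omega)).comp h2
      rw [tendsto_zero_iff_norm_tendsto_zero]
      have h4 := h3.inv_tendsto_atTop
      refine h4.congr fun t => ?_
      simp
    have h5 := (tendsto_finsetProd (Finset.univ) fun σ _ => h1 σ).const_mul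
      ((FractionalIdeal.absNorm 𝔞 : ℂ) ^ k)
    have h6 : ∏ _σ : K →+* ℝ, (0 : ℂ) = 0 := by
      rw [Finset.prod_const]
      exact zero_pow (by simp)
    rw [h6, mul_zero] at h5
    refine h5.congr fun t => ?_
    rw [eisTerm, div_eq_mul_inv, Finset.prod_inv_distrib]

end EisCT

set_option maxHeartbeats 4000000

/-- **Constant term of the partial Eisenstein series at the cusp `∞` after slashing by
`A⁻¹`.**  With notation as in the paper, the limit as `t → +∞` of
`F(it,…,it) = (α₃·(A⁻¹z) + α₄)^k ⬝ Σ_{(c,d)} N(𝔞)^k/(c·(A⁻¹z)+d)^k` exists and equals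
`Σ_{l ≡ a₂* (𝔫𝔞𝔟⁻¹), l ≠ 0} (N(𝔞)^k/N(l)^k) Σ_{𝔱 ∣ l𝒪𝔞⁻¹𝔟, (𝔱,𝔫)=1} μ(𝔱)`. -/
theorem eisenstein_constant_term
    (htotallyreal : Fintype.card (K →+* ℝ) = Module.finrank ℚ K)
    (α₁ α₂ α₃ α₄ : K) (hdet : α₁ * α₄ - α₂ * α₃ = 1)
    (𝔟 : FractionalIdeal (𝓞 K)⁰ K)
    (h𝔟 : 𝔟 = FractionalIdeal.spanSingleton (𝓞 K)⁰ α₃ + FractionalIdeal.spanSingleton (𝓞 K)⁰ α₄)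
    (h𝔟0 : 𝔟 ≠ 0)
    (htoprow : FractionalIdeal.spanSingleton (𝓞 K)⁰ α₁
        + FractionalIdeal.spanSingleton (𝓞 K)⁰ α₂ = 𝔟⁻¹)
    (𝔫 : Ideal (𝓞 K)) (h𝔫 : 𝔫 ≠ ⊥)
    (h𝔫𝔟 : ∀ v : IsDedekindDomain.HeightOneSpectrum (𝓞 K),
      v.asIdeal ∣ 𝔫 → FractionalIdeal.count K v 𝔟 = 0)
    (𝔞 : FractionalIdeal (𝓞 K)⁰ K) (h𝔞 : 𝔞 ≠ 0)
    (k : ℕ) (hk : 3 ≤ k)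
    (a₂ : K) (ha₂ : a₂ ∈ 𝔞)
    (I₂ : Ideal (𝓞 K))
    (hI₂ : (I₂ : FractionalIdeal (𝓞 K)⁰ K) = FractionalIdeal.spanSingleton (𝓞 K)⁰ a₂ * 𝔞⁻¹)
    (hI₂𝔫 : I₂ ⊔ 𝔫 = ⊤)
    (a₂star : K) (ha₂star : a₂star ∈ 𝔞 * 𝔟⁻¹)
    (ha₂star₁ : α₃ * a₂star ∈ (𝔫 : FractionalIdeal (𝓞 K)⁰ K) * 𝔞)
    (ha₂star₂ : α₄ * a₂star - a₂ ∈ (𝔫 : FractionalIdeal (𝓞 K)⁰ K) * 𝔞)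
    (S : Set (K × K))
    (hS : IsNPlusRepSet K 𝔫
      (fun v => v.1 ∈ 𝔞 ∧ v.2 ∈ 𝔞 ∧
        FractionalIdeal.spanSingleton (𝓞 K)⁰ v.1 + FractionalIdeal.spanSingleton (𝓞 K)⁰ v.2
          = 𝔞 ∧
        v.1 ∈ (𝔫 : FractionalIdeal (𝓞 K)⁰ K) * 𝔞 ∧
        v.2 - a₂ ∈ (𝔫 : FractionalIdeal (𝓞 K)⁰ K) * 𝔞) S)
    (L : Set K)
    (hL : IsNPlusRepSetElem K 𝔫
      (fun l => l ≠ 0 ∧ l ∈ 𝔞 * 𝔟⁻¹ ∧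
        l - a₂star ∈ (𝔫 : FractionalIdeal (𝓞 K)⁰ K) * (𝔞 * 𝔟⁻¹)) L)
    (J : K → Ideal (𝓞 K))
    (hJ : ∀ l ∈ L, (J l : FractionalIdeal (𝓞 K)⁰ K)
        = FractionalIdeal.spanSingleton (𝓞 K)⁰ l * 𝔞⁻¹ * 𝔟) :
    Filter.Tendsto
      (fun t : ℝ =>
        (∏ σ : K →+* ℝ,
            ((σ α₃ : ℂ) * matInvSMul K α₁ α₂ α₃ α₄ (fun _ => Complex.I * t) σ
              + (σ α₄ : ℂ)) ^ k) *
          ∑' v : S, eisTerm K 𝔞 k (matInvSMul K α₁ α₂ α₃ α₄ (fun _ => Complex.I * t)) v)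
      Filter.atTop
      (nhds (∑' l : L,
        ((FractionalIdeal.absNorm 𝔞 : ℂ) ^ k / ((∏ σ : K →+* ℝ, (σ (l : K) : ℂ)) ^ k)) *
          ∑' 𝔱 : {𝔱 : Ideal (𝓞 K) // 𝔱 ∣ J l ∧ 𝔱 ⊔ 𝔫 = ⊤}, (idealMoebius K 𝔱.1 : ℂ))) := by
  classical
  have hne : Nonempty (K →+* ℝ) := by
    rw [← Fintype.card_pos_iff, htotallyreal]
    exact Module.finrank_pos
  have hone : EisCT.Good K 𝔫 1 := ⟨fun σ => by simp, by simp⟩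
  have hSu : ∀ v ∈ S, ∀ w ∈ S, ∀ ε : (𝓞 K)ˣ, EisCT.Good K 𝔫 ε →
      v.1 = algebraMap (𝓞 K) K ε * w.1 → v.2 = algebraMap (𝓞 K) K ε * w.2 → v = w := by
    intro v hv w hw ε hε h1 h2
    exact (hS.2 v (hS.1 v hv)).unique ⟨hv, 1, hone.1, hone.2, by simp, by simp⟩
      ⟨hw, ε, hε.1, hε.2, h1, h2⟩
  have hLu : ∀ l ∈ L, ∀ l' ∈ L, ∀ ε : (𝓞 K)ˣ, EisCT.Good K 𝔫 ε →
      l = algebraMap (𝓞 K) K ε * l' → l = l' := by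
    intro v hv w hw ε hε h1
    exact (hL.2 v (hL.1 v hv)).unique ⟨hv, 1, hone.1, hone.2, by simp⟩
      ⟨hw, ε, hε.1, hε.2, h1⟩
  -- nonvanishing
  have hSne : ∀ v ∈ S, EisCT.cd K α₁ α₂ α₃ α₄ v ≠ 0 := by
    intro v hv h0
    obtain ⟨e1, e2⟩ := EisCT.cd_inv K hdet v
    rw [h0] at e1 e2
    simp only [Prod.fst_zero, Prod.snd_zero, zero_mul, add_zero] at e1 e2
    have h3 := (hS.1 v hv).2.2.1
    rw [e1, e2, FractionalIdeal.spanSingleton_zero, add_zero] at h3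
    exact h𝔞 h3.symm
  -- summability
  have hsum : Summable (fun v : S => ((∏ σ : K →+* ℝ,
      max |σ (EisCT.cd K α₁ α₂ α₃ α₄ v).1| |σ (EisCT.cd K α₁ α₂ α₃ α₄ v).2|)⁻¹) ^ k) := by
    set I : FractionalIdeal (𝓞 K)⁰ K := 𝔞 * (FractionalIdeal.spanSingleton (𝓞 K)⁰ α₁ +
      FractionalIdeal.spanSingleton (𝓞 K)⁰ α₂ + FractionalIdeal.spanSingleton (𝓞 K)⁰ α₃ +
      FractionalIdeal.spanSingleton (𝓞 K)⁰ α₄) with hI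
    have hmem : ∀ x ∈ 𝔞, x * α₁ ∈ I ∧ x * α₂ ∈ I ∧ x * α₃ ∈ I ∧ x * α₄ ∈ I := by
      intro x hx
      have hle := EisCT.span_le_four K (FractionalIdeal.spanSingleton (𝓞 K)⁰ α₁)
        (FractionalIdeal.spanSingleton (𝓞 K)⁰ α₂) (FractionalIdeal.spanSingleton (𝓞 K)⁰ α₃)
        (FractionalIdeal.spanSingleton (𝓞 K)⁰ α₄)
      exact ⟨FractionalIdeal.mul_mem_mul hx (FractionalIdeal.spanSingleton_le_iff_mem.mp hle.1),
        FractionalIdeal.mul_mem_mul hx (FractionalIdeal.spanSingleton_le_iff_mem.mp hle.2.1),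
        FractionalIdeal.mul_mem_mul hx (FractionalIdeal.spanSingleton_le_iff_mem.mp hle.2.2.1),
        FractionalIdeal.mul_mem_mul hx (FractionalIdeal.spanSingleton_le_iff_mem.mp hle.2.2.2)⟩
    obtain ⟨D, hD, hDI⟩ := I.isFractional
    refine EisCT.summable_reps K htotallyreal 𝔫 h𝔫 k hk
      (fun v : S => EisCT.cd K α₁ α₂ α₃ α₄ v) D (nonZeroDivisors.ne_zero hD) ?_
      (fun v => hSne v v.2) ?_
    · intro v
      obtain ⟨p1, p2, -⟩ := hS.1 v v.2
      have q1 := hmem _ p1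
      have q2 := hmem _ p2
      have r1 : (EisCT.cd K α₁ α₂ α₃ α₄ v).1 ∈ (I : Submodule (𝓞 K) K) :=
        Submodule.sub_mem _ q1.2.2.2 q2.2.2.1
      have r2 : (EisCT.cd K α₁ α₂ α₃ α₄ v).2 ∈ (I : Submodule (𝓞 K) K) :=
        Submodule.sub_mem _ q2.1 q1.2.1
      obtain ⟨x, hx⟩ := hDI _ r1
      obtain ⟨y, hy⟩ := hDI _ r2
      exact ⟨⟨x, hx.trans (Algebra.smul_def _ _)⟩, ⟨y, hy.trans (Algebra.smul_def _ _)⟩⟩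
    · intro v w ε hε h1 h2
      obtain ⟨e1, e2⟩ := EisCT.cd_inv K hdet v.1
      obtain ⟨f1, f2⟩ := EisCT.cd_inv K hdet w.1
      apply Subtype.ext
      apply hSu v v.2 w w.2 ε hε
      · rw [e1, h1, h2]
        conv_rhs => rw [f1]
        ring
      · rw [e2, h1, h2]
        conv_rhs => rw [f2]
        ring
  -- the limit
  have hlim := tendsto_tsum_of_dominated_convergence
    (f := fun (t : ℝ) (v : S) => eisTerm K 𝔞 k (fun _ => Complex.I * t)
      (EisCT.cd K α₁ α₂ α₃ α₄ v))
    (hsum.mul_left ‖(FractionalIdeal.absNorm 𝔞 : ℂ) ^ k‖)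
    (fun v => EisCT.tendsto_eisTerm K hne 𝔞 k hk (EisCT.cd K α₁ α₂ α₃ α₄ v))
    (by
      filter_upwards [Filter.eventually_ge_atTop (1 : ℝ)] with t ht v
      exact EisCT.norm_eisTerm_le K 𝔞 k t ht _ (hSne v v.2))
  have hlim2 := hlim.congr' (f₂ := fun t : ℝ =>
        (∏ σ : K →+* ℝ,
            ((σ α₃ : ℂ) * matInvSMul K α₁ α₂ α₃ α₄ (fun _ => Complex.I * t) σ
              + (σ α₄ : ℂ)) ^ k) *
          ∑' v : S, eisTerm K 𝔞 k (matInvSMul K α₁ α₂ α₃ α₄ (fun _ => Complex.I * t)) v) (by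
    filter_upwards [Filter.eventually_ge_atTop (1 : ℝ)] with t ht
    rw [← tsum_mul_left]
    exact tsum_congr fun v => (EisCT.slash_term K hdet 𝔞 k t (by linarith) v).symm)
  convert hlim2 using 2
  -- identification of the limit
  have hJ0 : ∀ l ∈ L, J l ≠ ⊥ := by
    intro l hl h0
    have h1 := hJ l hl
    rw [h0, FractionalIdeal.coeIdeal_bot] at h1
    have h2 : FractionalIdeal.spanSingleton (𝓞 K)⁰ l ≠ 0 :=
      FractionalIdeal.spanSingleton_ne_zero_iff.mpr (hL.1 l hl).1
    exact mul_ne_zero (mul_ne_zero h2 (inv_ne_zero h𝔞)) h𝔟0 h1.symm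
  have hRHS : ∀ l : L, ((FractionalIdeal.absNorm 𝔞 : ℂ) ^ k /
        ((∏ σ : K →+* ℝ, (σ (l : K) : ℂ)) ^ k)) *
          ∑' 𝔱 : {𝔱 : Ideal (𝓞 K) // 𝔱 ∣ J l ∧ 𝔱 ⊔ 𝔫 = ⊤}, (idealMoebius K 𝔱.1 : ℂ) =
      if J l = ⊤ then ((FractionalIdeal.absNorm 𝔞 : ℂ) ^ k /
        ((∏ σ : K →+* ℝ, (σ (l : K) : ℂ)) ^ k)) else 0 := by
    intro l
    rw [EisCT.moebius_sum K 𝔫 (J l) (hJ0 l l.2) (EisCT.J_sup_eq_top K h𝔞 h𝔟 h𝔟0 hI₂ hI₂𝔫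
      ha₂star₂ (hL.1 l l.2).2.2 (hJ l l.2))]
    split_ifs <;> simp
  rw [tsum_congr hRHS]
  -- from `l` to pairs
  have hrep : ∀ l : L, J l = ⊤ → ∃ w : S, NPlusEquiv K 𝔫 (α₃ * l, α₄ * l) w := by
    intro l hl
    obtain ⟨-, m1, m2⟩ := hL.1 l l.2
    rw [EisCT.mem_mul_inv_iff K h𝔟 h𝔟0] at m1
    rw [← mul_assoc, EisCT.mem_mul_inv_iff K h𝔟 h𝔟0] at m2
    rw [EisCT.J_eq_top_iff K h𝔞 (hJ l l.2)] at hl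
    obtain ⟨w, hw, -⟩ := hS.2 (α₃ * l, α₄ * l) (by
      refine ⟨m1.1, m1.2, ?_, ?_, ?_⟩
      · rw [← hl]
        exact EisCT.span_pair_eq K h𝔟 l
      · have : α₃ * (l : K) = α₃ * (l - a₂star) + α₃ * a₂star := by ring
        change α₃ * (l : K) ∈ _
        rw [this, ← FractionalIdeal.mem_coe]
        exact Submodule.add_mem _ m2.1 ha₂star₁
      · have : α₄ * (l : K) - a₂ = α₄ * (l - a₂star) + (α₄ * a₂star - a₂) := by ring
        change α₄ * (l : K) - a₂ ∈ _
        rw [this, ← FractionalIdeal.mem_coe]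
        exact Submodule.add_mem _ m2.2 ha₂star₂)
    exact ⟨⟨w, hw.1⟩, hw.2⟩
  have hmemJ : ∀ l : Function.support (fun l : L => if J l = ⊤ then
      ((FractionalIdeal.absNorm 𝔞 : ℂ) ^ k /
        ((∏ σ : K →+* ℝ, (σ (l : K) : ℂ)) ^ k)) else 0), J l.1 = ⊤ := by
    intro l
    by_contra hc
    exact l.2 (if_neg hc)
  choose i hi using fun l => hrep _ (hmemJ l)
  have hunit : ∀ ε : (𝓞 K)ˣ, algebraMap (𝓞 K) K ((ε⁻¹ : (𝓞 K)ˣ) : 𝓞 K) *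
      algebraMap (𝓞 K) K ε = 1 := by
    intro ε
    rw [← map_mul]
    simp
  have hcd : ∀ (l : K) (w : K × K) (ε : (𝓞 K)ˣ), α₃ * l = algebraMap (𝓞 K) K ε * w.1 →
      α₄ * l = algebraMap (𝓞 K) K ε * w.2 → (EisCT.cd K α₁ α₂ α₃ α₄ w).1 = 0 ∧
        l = algebraMap (𝓞 K) K ε * (EisCT.cd K α₁ α₂ α₃ α₄ w).2 := by
    intro l w ε h1 h2
    constructor
    · have : algebraMap (𝓞 K) K ε * (EisCT.cd K α₁ α₂ α₃ α₄ w).1 = 0 := by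
        simp only [EisCT.cd]
        linear_combination α₃ * h2 - α₄ * h1
      exact (mul_eq_zero.mp this).resolve_left (right_ne_zero_of_mul_eq_one (hunit ε))
    · simp only [EisCT.cd]
      linear_combination α₁ * h2 - α₂ * h1 - l * hdet
  refine (tsum_eq_tsum_of_ne_zero_bij i ?_ ?_ ?_).symm
  · intro l l' hll
    obtain ⟨ε, p1, p2, e1, e2⟩ := hi l
    obtain ⟨η, q1, q2, f1, f2⟩ := hi l'
    obtain ⟨-, g1⟩ := hcd _ _ ε e1 e2
    obtain ⟨-, g2⟩ := hcd _ _ η f1 f2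
    rw [← hll] at g2
    apply Subtype.ext
    apply Subtype.ext
    have hεη : EisCT.Good K 𝔫 (ε * η⁻¹) := EisCT.Good.mul K ⟨p1, p2⟩ (EisCT.Good.inv K ⟨q1, q2⟩)
    refine hLu _ l.1.2 _ l'.1.2 (ε * η⁻¹) hεη ?_
    rw [g1, g2]
    rw [Units.val_mul, map_mul]
    linear_combination - algebraMap (𝓞 K) K ε * (EisCT.cd K α₁ α₂ α₃ α₄ (i l)).2 * hunit η
  · intro v hv
    have hv1 : (EisCT.cd K α₁ α₂ α₃ α₄ v).1 = 0 := by
      by_contra hc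
      exact hv (if_neg hc)
    obtain ⟨e1, e2⟩ := EisCT.cd_inv K hdet v.1
    have hv0 := hSne v v.2
    obtain ⟨s1, s2, s3, s4, s5⟩ := hS.1 v v.2
    set l0 := (EisCT.cd K α₁ α₂ α₃ α₄ v).2 with hl0
    rw [hv1, zero_mul, zero_add, mul_comm] at e1 e2
    have hl00 : l0 ≠ 0 := fun h => hv0 (Prod.ext hv1 h)
    obtain ⟨l', ⟨hl'L, ε, p1, p2, p3⟩, -⟩ := hL.2 l0 (by
      refine ⟨hl00, ?_, ?_⟩
      · rw [EisCT.mem_mul_inv_iff K h𝔟 h𝔟0, ← e1, ← e2]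
        exact ⟨s1, s2⟩
      · rw [← mul_assoc, EisCT.mem_mul_inv_iff K h𝔟 h𝔟0, mul_sub, mul_sub, ← e1, ← e2]
        constructor
        · rw [← FractionalIdeal.mem_coe]
          exact Submodule.sub_mem _ s4 ha₂star₁
        · have : v.1.2 - α₄ * a₂star = (v.1.2 - a₂) - (α₄ * a₂star - a₂) := by ring
          rw [this, ← FractionalIdeal.mem_coe]
          exact Submodule.sub_mem _ s5 ha₂star₂)
    have hJl' : J l' = ⊤ := by
      rw [EisCT.J_eq_top_iff K h𝔞 (hJ l' hl'L), ← EisCT.span_unit_mul K ε l', ← p3,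
        ← EisCT.span_pair_eq K h𝔟, ← e1, ← e2]
      exact s3
    have hl'0 := (hL.1 l' hl'L).1
    have hsupp : (⟨l', hl'L⟩ : L) ∈ Function.support (fun l : L => if J l = ⊤ then
      ((FractionalIdeal.absNorm 𝔞 : ℂ) ^ k /
        ((∏ σ : K →+* ℝ, (σ (l : K) : ℂ)) ^ k)) else 0) := by
      rw [Function.mem_support]
      simp only [hJl', if_true]
      refine div_ne_zero (pow_ne_zero _ ?_) (pow_ne_zero _ (Finset.prod_ne_zero_iff.mpr ?_))
      · have := (FractionalIdeal.absNorm_eq_zero_iff (I := 𝔞)).not.mpr h𝔞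
        exact_mod_cast this
      · intro σ _
        have : σ l' ≠ 0 := (_root_.map_ne_zero σ).mpr hl'0
        exact_mod_cast this
    refine ⟨⟨_, hsupp⟩, ?_⟩
    obtain ⟨η, q1, q2, f1, f2⟩ := hi ⟨_, hsupp⟩
    have hεη : EisCT.Good K 𝔫 (ε * η) := EisCT.Good.mul K ⟨p1, p2⟩ ⟨q1, q2⟩
    apply Subtype.ext
    refine (hSu v v.2 _ (i ⟨_, hsupp⟩).2 (ε * η) hεη ?_ ?_).symm
    · rw [e1, p3]
      rw [Units.val_mul, map_mul]
      simp only at f1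
      linear_combination algebraMap (𝓞 K) K ε * f1
    · rw [e2, p3]
      rw [Units.val_mul, map_mul]
      simp only at f2
      linear_combination algebraMap (𝓞 K) K ε * f2
  · intro l
    obtain ⟨ε, p1, p2, e1, e2⟩ := hi l
    obtain ⟨g0, g1⟩ := hcd _ _ ε e1 e2
    have hε : EisCT.Good K 𝔫 ε := ⟨p1, p2⟩
    have hp := hε.prod_eq_one K htotallyreal
    simp only [hmemJ l, g0, if_true]
    congr 2
    have h3 : (∏ σ : K →+* ℝ, (σ (l.1 : K) : ℂ)) = ∏ σ : K →+* ℝ,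
        ((σ (algebraMap (𝓞 K) K ε) : ℂ) * (σ (EisCT.cd K α₁ α₂ α₃ α₄ (i l)).2 : ℂ)) := by
      refine Finset.prod_congr rfl fun σ _ => ?_
      rw [← Complex.ofReal_mul, ← map_mul, ← g1]
    rw [h3, Finset.prod_mul_distrib]
    have h4 : ∏ σ : K →+* ℝ, (σ (algebraMap (𝓞 K) K ε) : ℂ) = 1 := by exact_mod_cast hp
    rw [h4, one_mul]
end
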